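/- arXiv:2009.12685 — 3 statements merged into one kernel-verified Lean document; each statement's English description precedes it below -/
import Mathlib

section
/- Let δ ∈ (0,1), let A₁, …, A_{n+1} be independent standard Gaussian random vectors in ℝ^d with d = ⌊δn⌋, and let P_{n+1} = conv(A₁, …, A_{n+1}). Then (i) ℙ(diam(P_{n+1}) ≥ √d) ≥ 1 − e^{−nd/32}, and (ii) there exist constants 0 < c, c' < 1 depending only on δ such that lim inf_{n → ∞} ℙ(vf(P_{n+1}) ≤ c^d) ≥ c'. Consequently the conditioning measure vf(P_{n+1})/diam(P_{n+1}) is exponentially small in d with probability bounded below by a constant. -/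
open MeasureTheory ProbabilityTheory

/-- The standard Gaussian probability measure on `ℝ^d`. -/
noncomputable def stdGaussian (d : ℕ) : Measure (EuclideanSpace ℝ (Fin d)) :=
  (Measure.pi fun _ : Fin d => gaussianReal 0 1).map
    (MeasurableEquiv.toLp 2 (Fin d → ℝ))

/-- `F` is a facet of the polytope `P`: a nonempty exposed face whose affine dimension is one
less than that of `P`. -/
def IsFacetOf {d : ℕ} (P F : Set (EuclideanSpace ℝ (Fin d))) : Prop :=
  IsExposed ℝ P F ∧ F.Nonempty ∧
    Module.finrank ℝ (affineSpan ℝ F).direction + 1 =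
      Module.finrank ℝ (affineSpan ℝ P).direction

/-- The vertex-facet distance of a polytope `P`: the minimum over the facets `F` of `P` of the
distance from the affine hull of `F` to the vertices (extreme points) of `P` not on `F`. -/
noncomputable def vf {d : ℕ} (P : Set (EuclideanSpace ℝ (Fin d))) : ℝ :=
  sInf { r : ℝ | ∃ F : Set (EuclideanSpace ℝ (Fin d)), IsFacetOf P F ∧
    r = sInf { s : ℝ | ∃ v ∈ Set.extremePoints ℝ P, v ∉ F ∧
      s = Metric.infDist v (affineSpan ℝ F : Set (EuclideanSpace ℝ (Fin d))) } }

open scoped NNReal ENNReal InnerProductSpace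

lemma stdGaussian_eq (d : ℕ) :
    _root_.stdGaussian d = ProbabilityTheory.stdGaussian (EuclideanSpace ℝ (Fin d)) :=
  map_pi_eq_stdGaussian

instance stdGaussian_isProbabilityMeasure (d : ℕ) :
    IsProbabilityMeasure (_root_.stdGaussian d) := by
  rw [stdGaussian_eq]; infer_instance

lemma stdGaussian_charFun {d : ℕ} (t : EuclideanSpace ℝ (Fin d)) :
    charFun (_root_.stdGaussian d) t = Complex.exp (-(‖t‖ : ℂ) ^ 2 / 2) := by
  rw [stdGaussian_eq, charFun_stdGaussian]

/-- A linear combination of independent standard Gaussian vectors is a rescaled standard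
Gaussian vector. -/
lemma map_sum_smul_pi_stdGaussian {ι : Type*} [Fintype ι] {d : ℕ} (c : ι → ℝ) :
    (Measure.pi fun _ : ι => _root_.stdGaussian d).map (fun A => ∑ i, c i • A i) =
      (_root_.stdGaussian d).map (fun x => √(∑ i, c i ^ 2) • x) := by
  have h1 : (fun A : ι → EuclideanSpace ℝ (Fin d) => ∑ i, c i • A i) =
      (fun p : ι → EuclideanSpace ℝ (Fin d) => ∑ i, p i) ∘ (fun A i => c i • A i) := rfl
  have h2 : ∀ i, IsProbabilityMeasure ((_root_.stdGaussian d).map (fun x => c i • x)) :=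
    fun i => Measure.isProbabilityMeasure_map (by fun_prop)
  rw [h1, ← Measure.map_map (by fun_prop) (by fun_prop), Measure.pi_map_pi (by fun_prop)]
  apply Measure.ext_of_charFun
  rw [charFun_map_sum_pi_eq_prod]
  ext t
  simp only [Finset.prod_apply, charFun_map_smul, stdGaussian_charFun, norm_smul,
    ← Complex.exp_sum]
  congr 1
  rw [← Complex.ofReal_pow, mul_pow, Real.norm_eq_abs, sq_abs, Real.sq_sqrt (by positivity)]
  push_cast
  rw [Finset.sum_mul, ← Finset.sum_neg_distrib, Finset.sum_div]
  refine Finset.sum_congr rfl fun i _ => ?_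
  rw [mul_pow, Real.norm_eq_abs, ← Complex.ofReal_pow, sq_abs]
  push_cast; rfl

lemma map_inner_stdGaussian {d : ℕ} (a : EuclideanSpace ℝ (Fin d)) :
    (_root_.stdGaussian d).map (fun x => ⟪a, x⟫_ℝ) = gaussianReal 0 (‖a‖₊ ^ 2) := by
  have : IsProbabilityMeasure ((_root_.stdGaussian d).map (fun x => ⟪a, x⟫_ℝ)) :=
    Measure.isProbabilityMeasure_map (by fun_prop)
  apply Measure.ext_of_charFun
  ext t
  rw [charFun_gaussianReal, charFun_apply_real, integral_map (by fun_prop) (by fun_prop)]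
  have := stdGaussian_charFun (t • a)
  rw [charFun_apply] at this
  simp only [inner_smul_right, fun x => real_inner_comm a x] at this
  push_cast at this
  rw [this, norm_smul]
  congr 1
  push_cast
  rw [mul_pow, ← Complex.ofReal_pow, Real.norm_eq_abs, sq_abs]
  push_cast
  ring

/-- Two orthogonal unit directions of a standard Gaussian vector are independent. -/
lemma map_inner_prod_stdGaussian {d : ℕ} {u e : EuclideanSpace ℝ (Fin d)} (hu : ‖u‖ = 1)
    (he : ‖e‖ = 1) (hue : ⟪u, e⟫_ℝ = 0) :
    (_root_.stdGaussian d).map (fun x => (⟪u, x⟫_ℝ, ⟪e, x⟫_ℝ)) =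
      (gaussianReal 0 1).prod (gaussianReal 0 1) := by
  have hg : HasGaussianLaw (fun x : EuclideanSpace ℝ (Fin d) => (⟪u, x⟫_ℝ, ⟪e, x⟫_ℝ))
      (_root_.stdGaussian d) := by
    have : HasGaussianLaw (id : EuclideanSpace ℝ (Fin d) → _) (_root_.stdGaussian d) := by
      rw [stdGaussian_eq]; exact ⟨by rw [Measure.map_id]; infer_instance⟩
    exact this.map ((innerSL ℝ u).prod (innerSL ℝ e))
  have hind := hg.indepFun_of_covariance_eq_zero (by
    rw [stdGaussian_eq, ← covarianceBilin_apply_eq_cov, covarianceBilin_stdGaussian]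
    · rw [innerSL_apply_apply, hue]
    · exact IsGaussian.memLp_two_id)
  rw [indepFun_iff_map_prod_eq_prod_map_map (by fun_prop) (by fun_prop)] at hind
  rw [hind, map_inner_stdGaussian, map_inner_stdGaussian]
  have h1 : ‖u‖₊ = 1 := by ext; simpa using hu
  have h2 : ‖e‖₊ = 1 := by ext; simpa using he
  simp [h1, h2]

/-- The exponential Markov inequality for a sum of independent identically distributed terms. -/
lemma pi_real_le_sum_le {ι : Type*} [Fintype ι] (ν : Measure ℝ) [IsProbabilityMeasure ν]
    {f : ℝ → ℝ} (hfi : Integrable (fun x => Real.exp (f x)) ν) {m : ℝ}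
    (hm : ∫ x, Real.exp (f x) ∂ν ≤ m) (T : ℝ) :
    (Measure.pi fun _ : ι => ν).real {y | T ≤ ∑ i, f (y i)} ≤
      Real.exp (-T) * m ^ Fintype.card ι := by
  have hprod : ∀ y : ι → ℝ, Real.exp (∑ i, f (y i)) = ∏ i, Real.exp (f (y i)) :=
    fun y => Real.exp_sum _ _
  have hi : Integrable (fun y : ι → ℝ => Real.exp (∑ i, f (y i)))
      (Measure.pi fun _ : ι => ν) := by
    simp only [hprod]
    exact Integrable.fintype_prod (fun _ => hfi)
  have h := mul_meas_ge_le_integral_of_nonneg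
    (Filter.Eventually.of_forall fun y => (Real.exp_pos _).le) hi (Real.exp T)
  have he : ∫ y : ι → ℝ, Real.exp (∑ i, f (y i)) ∂(Measure.pi fun _ : ι => ν) =
      (∫ x, Real.exp (f x) ∂ν) ^ Fintype.card ι := by
    simp only [hprod]
    exact integral_fintype_prod_eq_pow (fun x => Real.exp (f x))
  rw [he] at h
  simp only [Real.exp_le_exp] at h
  rw [Real.exp_neg, inv_mul_eq_div, le_div_iff₀' (Real.exp_pos _)]
  refine h.trans (pow_le_pow_left₀ (integral_nonneg fun _ => (Real.exp_pos _).le) hm _)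

lemma integrable_gaussianReal_iff_smul {f : ℝ → ℝ} {v : ℝ≥0} (hv : v ≠ 0) :
    Integrable f (gaussianReal 0 v) ↔ Integrable (fun x => gaussianPDFReal 0 v x * f x) := by
  rw [gaussianReal_of_var_ne_zero _ hv,
    integrable_withDensity_iff_integrable_smul' (measurable_gaussianPDF _ _)
      (Filter.Eventually.of_forall fun _ => gaussianPDF_lt_top)]
  simp only [toReal_gaussianPDF, smul_eq_mul]

lemma gaussianPDFReal_mul_exp_sq (t x : ℝ) :
    gaussianPDFReal 0 1 x * Real.exp (t * x ^ 2) =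
      (√(2 * Real.pi))⁻¹ * Real.exp (-(1 / 2 - t) * x ^ 2) := by
  rw [gaussianPDFReal_def]
  simp only [NNReal.coe_one, mul_one, sub_zero]
  rw [mul_assoc, ← Real.exp_add]
  congr 2
  ring

lemma integrable_exp_sq_gaussianReal {t : ℝ} (ht : t < 1 / 2) :
    Integrable (fun x => Real.exp (t * x ^ 2)) (gaussianReal 0 1) := by
  rw [integrable_gaussianReal_iff_smul one_ne_zero]
  simp only [gaussianPDFReal_mul_exp_sq]
  exact (integrable_exp_neg_mul_sq (by linarith)).const_mul _

lemma integral_exp_sq_gaussianReal {t : ℝ} (ht : t < 1 / 2) :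
    ∫ x, Real.exp (t * x ^ 2) ∂(gaussianReal 0 1) = (√(1 - 2 * t))⁻¹ := by
  rw [integral_gaussianReal_eq_integral_smul one_ne_zero]
  simp only [smul_eq_mul, gaussianPDFReal_mul_exp_sq]
  rw [integral_const_mul, integral_gaussian, ← Real.sqrt_inv, ← Real.sqrt_inv,
    ← Real.sqrt_mul (by positivity)]
  congr 1
  have := Real.pi_pos
  have h : (1 / 2 - t) ≠ 0 := by linarith
  have h' : (1 - 2 * t) ≠ 0 := by linarith
  field_simp

lemma gaussianPDFReal_zero_le (v : ℝ≥0) (x : ℝ) :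
    gaussianPDFReal 0 v x ≤ (√(v : ℝ))⁻¹ := by
  rcases eq_or_ne v 0 with rfl | hv
  · simp
  have hv' : (0 : ℝ) < v := by positivity
  rw [gaussianPDFReal_def]
  calc (√(2 * Real.pi * v))⁻¹ * Real.exp (-(x - 0) ^ 2 / (2 * v))
      ≤ (√(2 * Real.pi * v))⁻¹ * 1 := by
        gcongr
        rw [Real.exp_le_one_iff, neg_div]
        have : 0 ≤ (x - 0) ^ 2 / (2 * (v : ℝ)) := by positivity
        linarith
    _ ≤ (√(v : ℝ))⁻¹ := by
        rw [mul_one]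
        gcongr
        nlinarith [Real.pi_gt_three]

lemma integral_exp_neg_mul_abs {s : ℝ} (hs : 0 < s) (t : ℝ) :
    ∫ x : ℝ, Real.exp (-s * |x - t|) = 2 / s := by
  rw [integral_sub_right_eq_self (fun x : ℝ => Real.exp (-s * |x|)) t,
    integral_comp_abs (f := fun x => Real.exp (-s * x)), integral_exp_mul_Ioi (by linarith)]
  simp
  ring

lemma integrable_exp_neg_mul_abs {s : ℝ} (hs : 0 < s) (t : ℝ) :
    Integrable (fun x : ℝ => Real.exp (-s * |x - t|)) := by
  by_contra h
  have h1 := integral_exp_neg_mul_abs hs t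
  rw [integral_undef h] at h1
  have : 0 < 2 / s := by positivity
  linarith

lemma integrable_exp_neg_mul_abs_gaussianReal {s : ℝ} (hs : 0 < s) (t : ℝ) {v : ℝ≥0} :
    Integrable (fun x : ℝ => Real.exp (-s * |x - t|)) (gaussianReal 0 v) := by
  refine Integrable.of_bound (C := 1) (by fun_prop) (Filter.Eventually.of_forall fun x => ?_)
  rw [Real.norm_of_nonneg (Real.exp_pos _).le, Real.exp_le_one_iff]
  have : 0 ≤ s * |x - t| := by positivity
  linarith

lemma integral_exp_neg_mul_abs_gaussianReal_le {s : ℝ} (hs : 0 < s) (t : ℝ) {v : ℝ≥0}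
    (hv : v ≠ 0) :
    ∫ x, Real.exp (-s * |x - t|) ∂(gaussianReal 0 v) ≤ (√(v : ℝ))⁻¹ * (2 / s) := by
  rw [integral_gaussianReal_eq_integral_smul hv, ← integral_exp_neg_mul_abs hs t,
    ← integral_const_mul]
  simp only [smul_eq_mul]
  refine integral_mono ?_ ((integrable_exp_neg_mul_abs hs t).const_mul _) fun x => ?_
  · rw [← integrable_gaussianReal_iff_smul hv]
    exact integrable_exp_neg_mul_abs_gaussianReal hs t
  · exact mul_le_mul_of_nonneg_right (gaussianPDFReal_zero_le v x) (Real.exp_pos _).le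

lemma gaussianReal_real_Ico_le (a b : ℝ) (hab : a ≤ b) :
    (gaussianReal 0 1).real (Set.Ico a b) ≤ b - a := by
  rw [Measure.real, gaussianReal_apply_eq_integral _ one_ne_zero,
    ENNReal.toReal_ofReal (integral_nonneg fun x => gaussianPDFReal_nonneg _ _ _)]
  calc ∫ x in Set.Ico a b, gaussianPDFReal 0 1 x ≤ ∫ x in Set.Ico a b, (1 : ℝ) := by
        refine integral_mono (integrable_gaussianPDFReal _ _).integrableOn (by simp) fun x => ?_
        simpa using gaussianPDFReal_zero_le 1 x
    _ = b - a := by simp [hab]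

lemma le_gaussianReal_real_Ico {h ε H : ℝ} (hh : |h| ≤ H) (hε0 : 0 ≤ ε) (hε : ε ≤ 1) :
    ε * gaussianPDFReal 0 1 (H + 1) ≤ (gaussianReal 0 1).real (Set.Ico (h - ε) h) := by
  rw [Measure.real, gaussianReal_apply_eq_integral _ one_ne_zero,
    ENNReal.toReal_ofReal (integral_nonneg fun x => gaussianPDFReal_nonneg _ _ _)]
  calc ε * gaussianPDFReal 0 1 (H + 1)
      = ∫ x in Set.Ico (h - ε) h, gaussianPDFReal 0 1 (H + 1) := by simp [hε0]
    _ ≤ _ := by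
        refine setIntegral_mono_on (by simp) (integrable_gaussianPDFReal _ _).integrableOn
          measurableSet_Ico fun x hx => ?_
        simp only [gaussianPDFReal_def]
        have hx2 : (x - 0) ^ 2 ≤ (H + 1 - 0) ^ 2 := by
          rw [sub_zero, sub_zero, ← sq_abs x]
          have := abs_le.1 hh
          exact pow_le_pow_left₀ (abs_nonneg x)
            (abs_le.2 ⟨by linarith [hx.1], by linarith [hx.2]⟩) 2
        gcongr

lemma stdGaussian_real_le_inner {d : ℕ} (a : EuclideanSpace ℝ (Fin d)) {R T : ℝ} (hR : 0 < R)
    (ha : ‖a‖ ≤ R) (hT : 0 ≤ T) :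
    (_root_.stdGaussian d).real {x | T ≤ ⟪a, x⟫_ℝ} ≤ Real.exp (-(T ^ 2 / (2 * R ^ 2))) := by
  have hmgf : ∀ t, mgf (fun x => ⟪a, x⟫_ℝ) (_root_.stdGaussian d) t =
      Real.exp (‖a‖ ^ 2 * t ^ 2 / 2) := fun t => by
    rw [mgf_gaussianReal (map_inner_stdGaussian a)]; simp
  have h := measure_ge_le_exp_mul_mgf (μ := _root_.stdGaussian d) (X := fun x => ⟪a, x⟫_ℝ) T
    (t := T / R ^ 2) (by positivity) (by
      by_contra hcon
      have h1 := hmgf (T / R ^ 2)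
      rw [mgf_undef hcon] at h1
      exact (Real.exp_pos _).ne h1)
  refine h.trans ?_
  rw [hmgf, ← Real.exp_add, Real.exp_le_exp]
  have : ‖a‖ ^ 2 * (T / R ^ 2) ^ 2 / 2 ≤ R ^ 2 * (T / R ^ 2) ^ 2 / 2 := by gcongr
  refine (add_le_add_right this _).trans (le_of_eq ?_)
  field_simp
  ring

/-- Lower tail of the squared norm of a standard Gaussian vector. -/
lemma stdGaussian_real_norm_sq_le (d : ℕ) {s : ℝ} (hs : 0 ≤ s) (R : ℝ) :
    (_root_.stdGaussian d).real {x | ‖x‖ ^ 2 ≤ R} ≤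
      Real.exp (s * R) * (√(1 + 2 * s))⁻¹ ^ d := by
  rcases hs.eq_or_lt with rfl | hs
  · simp
  have h := pi_real_le_sum_le (ι := Fin d) (gaussianReal 0 1) (f := fun x => -s * x ^ 2)
    (integrable_exp_sq_gaussianReal (by linarith))
    (integral_exp_sq_gaussianReal (by linarith)).le (-(s * R))
  rw [neg_neg, Fintype.card_fin, show 1 - 2 * -s = 1 + 2 * s by ring] at h
  refine le_trans (le_of_eq ?_) h
  rw [_root_.stdGaussian, map_measureReal_apply (MeasurableEquiv.measurable _)
    (measurableSet_le (by fun_prop) (by fun_prop))]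
  congr 1
  ext y
  simp only [Set.preimage_ofPred_eq, Set.mem_ofPred_eq, MeasurableEquiv.coe_toLp,
    EuclideanSpace.real_norm_sq_eq, ← Finset.mul_sum]
  rw [neg_mul, neg_le_neg_iff, mul_le_mul_iff_right₀ hs]

/-- Lower tail of the norm of a linear combination of independent Gaussian vectors. -/
lemma pi_stdGaussian_real_norm_sum_le {ι : Type*} [Fintype ι] (d : ℕ) (c : ι → ℝ) {σ : ℝ}
    (hσ : σ ≤ ∑ i, c i ^ 2) (hσ0 : 0 < σ) {s : ℝ} (hs : 0 ≤ s) (R : ℝ) :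
    (Measure.pi fun _ : ι => _root_.stdGaussian d).real {A | ‖∑ i, c i • A i‖ ^ 2 ≤ σ * R} ≤
      Real.exp (s * R) * (√(1 + 2 * s))⁻¹ ^ d := by
  refine le_trans ?_ (stdGaussian_real_norm_sq_le d hs R)
  have hm : MeasurableSet {x : EuclideanSpace ℝ (Fin d) | ‖x‖ ^ 2 ≤ σ * R} :=
    measurableSet_le (by fun_prop) (by fun_prop)
  have h := congrArg (fun μ : Measure (EuclideanSpace ℝ (Fin d)) =>
    μ.real {x | ‖x‖ ^ 2 ≤ σ * R}) (map_sum_smul_pi_stdGaussian (d := d) c)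
  simp only [map_measureReal_apply (f := fun A : ι → EuclideanSpace ℝ (Fin d) => ∑ i, c i • A i)
      (by fun_prop) hm,
    map_measureReal_apply (f := fun x : EuclideanSpace ℝ (Fin d) => √(∑ i, c i ^ 2) • x)
      (by fun_prop) hm, Set.preimage_ofPred_eq] at h
  rw [h]
  refine measureReal_mono fun x hx => ?_
  simp only [Set.mem_ofPred_eq, norm_smul, mul_pow, Real.norm_eq_abs, sq_abs] at hx ⊢
  rw [Real.sq_sqrt (by positivity)] at hx
  have : σ * ‖x‖ ^ 2 ≤ σ * R := le_trans (by gcongr) hx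
  exact le_of_mul_le_mul_left this hσ0

lemma map_inner_pi_stdGaussian {ι : Type*} [Fintype ι] {d : ℕ} (a : EuclideanSpace ℝ (Fin d)) :
    (Measure.pi fun _ : ι => _root_.stdGaussian d).map (fun A i => ⟪a, A i⟫_ℝ) =
      Measure.pi fun _ : ι => gaussianReal 0 (‖a‖₊ ^ 2) := by
  have : ∀ _ : ι, IsProbabilityMeasure ((_root_.stdGaussian d).map (fun x => ⟪a, x⟫_ℝ)) :=
    fun i => Measure.isProbabilityMeasure_map (by fun_prop)
  rw [Measure.pi_map_pi (f := fun _ x => ⟪a, x⟫_ℝ) (by fun_prop)]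
  simp only [map_inner_stdGaussian]

lemma measurePreserving_pi_split_two {α : Type*} [MeasurableSpace α] (γ : Measure α)
    [IsProbabilityMeasure γ] (N : ℕ) :
    MeasurePreserving (fun ω : Fin (N + 2) → α => ((ω 0, ω 1), fun i : Fin N => ω i.succ.succ))
      (Measure.pi fun _ => γ) ((γ.prod γ).prod (Measure.pi fun _ => γ)) := by
  have h1 := measurePreserving_piFinSuccAbove (fun _ : Fin (N + 2) => γ) 0
  have h2 := measurePreserving_piFinSuccAbove (fun _ : Fin (N + 1) => γ) 0
  have h3 := ((MeasurePreserving.id γ).prod h2).comp h1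
  exact (measurePreserving_prodAssoc γ γ (Measure.pi fun _ : Fin N => γ)).symm.comp h3

/-- Splitting points into disjoint pairs bounds the probability that all of them are close. -/
lemma pi_real_forall_dist_lt_le {α : Type*} [PseudoMetricSpace α] [MeasurableSpace α]
    [OpensMeasurableSpace α] [SecondCountableTopology α] (γ : Measure α)
    [IsProbabilityMeasure γ] (D : ℝ) (N : ℕ) :
    (Measure.pi fun _ : Fin N => γ).real {ω | ∀ i j, dist (ω i) (ω j) < D} ≤
      (γ.prod γ).real {p | dist p.1 p.2 < D} ^ (N / 2) := by
  induction N using Nat.twoStepInduction with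
  | zero => simp
  | one => simp
  | more N ih _ =>
    have hm1 : MeasurableSet {p : α × α | dist p.1 p.2 < D} :=
      measurableSet_lt (by fun_prop) (by fun_prop)
    have hm2 : MeasurableSet {ω : Fin N → α | ∀ i j, dist (ω i) (ω j) < D} := by
      have : {ω : Fin N → α | ∀ i j, dist (ω i) (ω j) < D} =
          ⋂ i, ⋂ j, {ω | dist (ω i) (ω j) < D} := by ext; simp
      rw [this]
      exact .iInter fun i => .iInter fun j => measurableSet_lt (by fun_prop) (by fun_prop)
    have hmp := measurePreserving_pi_split_two γ N
    calc (Measure.pi fun _ : Fin (N + 2) => γ).real {ω | ∀ i j, dist (ω i) (ω j) < D}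
        ≤ (Measure.pi fun _ : Fin (N + 2) => γ).real
          ((fun ω : Fin (N + 2) → α => ((ω 0, ω 1), fun i : Fin N => ω i.succ.succ)) ⁻¹'
            ({p | dist p.1 p.2 < D} ×ˢ {ω | ∀ i j, dist (ω i) (ω j) < D})) :=
          measureReal_mono fun ω hω => ⟨hω _ _, fun i j => hω _ _⟩
      _ = (γ.prod γ).real {p | dist p.1 p.2 < D} *
            (Measure.pi fun _ : Fin N => γ).real {ω | ∀ i j, dist (ω i) (ω j) < D} := by
          rw [Measure.real, hmp.measure_preimage (hm1.prod hm2).nullMeasurableSet,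
            Measure.prod_prod, ENNReal.toReal_mul]; rfl
      _ ≤ _ := by
          rw [show (N + 2) / 2 = N / 2 + 1 by omega, pow_succ']
          gcongr

lemma stdGaussian_prod_real_dist_lt_le (d : ℕ) :
    ((_root_.stdGaussian d).prod (_root_.stdGaussian d)).real {p | dist p.1 p.2 < √d} ≤
      Real.exp (-(d / 16 : ℝ)) := by
  have h := pi_stdGaussian_real_norm_sum_le d (![1, -1] : Fin 2 → ℝ) (σ := 2)
    (by simp [Fin.sum_univ_two]; norm_num) two_pos (s := 1 / 2) (by norm_num) (d / 2 : ℝ)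
  have hm : MeasurableSet {p : EuclideanSpace ℝ (Fin d) × EuclideanSpace ℝ (Fin d) |
      dist p.1 p.2 < √d} := measurableSet_lt (by fun_prop) (by fun_prop)
  have hp := measurePreserving_finTwoArrow (_root_.stdGaussian d)
  calc _ = (Measure.pi fun _ : Fin 2 => _root_.stdGaussian d).real
        (MeasurableEquiv.finTwoArrow ⁻¹' {p | dist p.1 p.2 < √d}) := by
        rw [Measure.real, Measure.real, hp.measure_preimage hm.nullMeasurableSet]
    _ ≤ _ := by
        refine measureReal_mono fun ω hω => ?_
        have hω' : dist (ω 0) (ω 1) < √d := hω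
        simp only [Set.mem_ofPred_eq, Fin.sum_univ_two, Matrix.cons_val_zero,
          Matrix.cons_val_one, one_smul, neg_smul, ← sub_eq_add_neg, ← dist_eq_norm]
        have := pow_le_pow_left₀ dist_nonneg hω'.le 2
        rw [Real.sq_sqrt (by positivity)] at this
        linarith
    _ ≤ _ := h
    _ ≤ _ := by
        have h2 : (√(1 + 2 * (1 / 2) : ℝ))⁻¹ = Real.exp (-(Real.log 2 / 2)) := by
          rw [Real.exp_neg, ← Real.log_sqrt (by norm_num), Real.exp_log (by positivity)]
          norm_num
        rw [h2, ← Real.exp_nat_mul, ← Real.exp_add, Real.exp_le_exp]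
        have := Real.log_two_gt_d9
        have hd : (0 : ℝ) ≤ d := by positivity
        nlinarith

lemma le_pi_stdGaussian_sqrt_le_diam (n d : ℕ) :
    ENNReal.ofReal (1 - Real.exp (-((n : ℝ) * (d : ℝ)) / 32)) ≤
      (Measure.pi fun _ : Fin (n + 1) => _root_.stdGaussian d)
        {ω | √(d : ℝ) ≤ Metric.diam (convexHull ℝ (Set.range ω))} := by
  set S := {ω : Fin (n + 1) → EuclideanSpace ℝ (Fin d) | ∀ i j, dist (ω i) (ω j) < √d} with hS
  have hm : MeasurableSet S := by
    have : S = ⋂ i, ⋂ j, {ω | dist (ω i) (ω j) < √d} := by ext; simp [hS]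
    rw [this]
    exact .iInter fun i => .iInter fun j => measurableSet_lt (by fun_prop) (by fun_prop)
  have hsub : Sᶜ ⊆ {ω | √(d : ℝ) ≤ Metric.diam (convexHull ℝ (Set.range ω))} := by
    intro ω hω
    simp only [hS, Set.mem_compl_iff, Set.mem_ofPred_eq, not_forall, not_lt] at hω ⊢
    obtain ⟨i, j, hij⟩ := hω
    rw [convexHull_diam]
    exact hij.trans (Metric.dist_le_diam_of_mem (Set.finite_range ω).isBounded ⟨i, rfl⟩ ⟨j, rfl⟩)
  refine le_trans ?_ (measure_mono hsub)
  rw [← ofReal_measureReal, probReal_compl_eq_one_sub hm]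
  refine ENNReal.ofReal_le_ofReal (sub_le_sub_left ?_ _)
  refine (pi_real_forall_dist_lt_le _ _ _).trans ?_
  refine (pow_le_pow_left₀ measureReal_nonneg (stdGaussian_prod_real_dist_lt_le d) _).trans ?_
  rw [← Real.exp_nat_mul, Real.exp_le_exp]
  have h1 : (n : ℝ) / 2 ≤ ((n + 1) / 2 : ℕ) := by
    rw [div_le_iff₀ two_pos]
    exact_mod_cast (by omega : n ≤ (n + 1) / 2 * 2)
  have hd : (0 : ℝ) ≤ d := by positivity
  nlinarith

lemma sum_Icc_exp_neg_mul_abs_le {η : ℝ} (hη : 0 < η) (K : ℕ) :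
    ∑ k ∈ Finset.Icc (-(K : ℤ)) K, Real.exp (-η * |(k : ℝ)|) ≤
      1 + 2 / η * (1 - Real.exp (-η * K)) := by
  induction K with
  | zero => simp
  | succ K ih =>
    have hI : Finset.Icc (-((K + 1 : ℕ) : ℤ)) ((K + 1 : ℕ) : ℤ) =
        insert (-(K + 1 : ℤ)) (insert (K + 1 : ℤ) (Finset.Icc (-(K : ℤ)) K)) := by
      ext x; simp only [Finset.mem_Icc, Finset.mem_insert]; push_cast; omega
    rw [hI, Finset.sum_insert (by simp; omega), Finset.sum_insert (by simp)]
    have h1 : |((-(K + 1 : ℤ) : ℤ) : ℝ)| = K + 1 := by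
      push_cast; rw [abs_neg, abs_of_nonneg (by positivity)]
    have h2 : |((K + 1 : ℤ) : ℝ)| = K + 1 := by
      push_cast; rw [abs_of_nonneg (by positivity)]
    rw [h1, h2]
    push_cast
    have h3 : Real.exp (-η * K) = Real.exp η * Real.exp (-η * (K + 1)) := by
      rw [← Real.exp_add]; congr 1; ring
    have h4 := Real.add_one_le_exp η
    have h5 := Real.exp_pos (-η * (K + 1))
    have h6 : 2 * Real.exp (-η * (K + 1)) ≤
        2 / η * (Real.exp (-η * K) - Real.exp (-η * (K + 1))) := by
      rw [h3, div_mul_eq_mul_div, le_div_iff₀ hη]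
      nlinarith
    linarith

/-- The number of integer points in an `ℓ¹`-ball. -/
lemma exists_finset_int_card_le (ι : Type*) [Fintype ι] {η : ℝ} (hη : 0 < η) (hη1 : η ≤ 1) :
    ∃ Z : Finset (ι → ℤ), (∀ z : ι → ℤ, ∑ i, |(z i : ℝ)| ≤ Fintype.card ι / η → z ∈ Z) ∧
      (Z.card : ℝ) ≤ (9 / η) ^ Fintype.card ι := by
  classical
  set L := Fintype.card ι
  set K := ⌊(L : ℝ) / η⌋₊
  set B := Fintype.piFinset (fun _ : ι => Finset.Icc (-(K : ℤ)) K)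
  refine ⟨B.filter (fun z => ∑ i, |(z i : ℝ)| ≤ L / η), fun z hz => ?_, ?_⟩
  · refine Finset.mem_filter.2 ⟨Fintype.mem_piFinset.2 fun i => ?_, hz⟩
    have h1 : |(z i : ℝ)| ≤ L / η :=
      (Finset.single_le_sum (f := fun i => |(z i : ℝ)|) (fun _ _ => abs_nonneg _)
        (Finset.mem_univ i)).trans hz
    have h2 : (z i).natAbs ≤ K := Nat.le_floor (by rwa [Nat.cast_natAbs, Int.cast_abs])
    rw [Finset.mem_Icc]; omega
  · have h1 : ∑ z ∈ B, ∏ i, Real.exp (-η * |(z i : ℝ)|) ≤ (3 / η) ^ L := by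
      rw [← Finset.prod_univ_sum (t := fun _ : ι => Finset.Icc (-(K : ℤ)) K)
        (f := fun _ k => Real.exp (-η * |(k : ℝ)|)), Finset.prod_const, Finset.card_univ]
      refine pow_le_pow_left₀ (Finset.sum_nonneg fun _ _ => (Real.exp_pos _).le) ?_ _
      refine (sum_Icc_exp_neg_mul_abs_le hη K).trans ?_
      have := Real.exp_pos (-η * K)
      have h2 : 2 / η * (1 - Real.exp (-η * K)) ≤ 2 / η := by
        have : 0 < 2 / η := by positivity
        nlinarith
      have h3 : 1 ≤ 1 / η := by rw [le_div_iff₀ hη]; linarith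
      have h4 : 3 / η = 1 / η + 2 / η := by ring
      linarith
    have h2 : ((B.filter (fun z => ∑ i, |(z i : ℝ)| ≤ L / η)).card : ℝ) * Real.exp (-L) ≤
        ∑ z ∈ B, ∏ i, Real.exp (-η * |(z i : ℝ)|) := by
      rw [← nsmul_eq_mul, ← Finset.sum_const]
      refine (Finset.sum_le_sum fun z hz => ?_).trans
        (Finset.sum_le_sum_of_subset_of_nonneg (Finset.filter_subset _ _)
          fun z _ _ => Finset.prod_nonneg fun _ _ => (Real.exp_pos _).le)
      rw [← Real.exp_sum, Real.exp_le_exp, ← Finset.mul_sum]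
      have := (Finset.mem_filter.1 hz).2
      rw [le_div_iff₀ hη] at this
      linarith
    have h3 := h2.trans h1
    rw [Real.exp_neg, ← div_eq_mul_inv, div_le_iff₀ (Real.exp_pos _)] at h3
    refine h3.trans ?_
    rw [← Real.exp_one_pow, ← mul_pow]
    refine pow_le_pow_left₀ (by positivity) ?_ _
    rw [div_mul_eq_mul_div]
    gcongr
    have := Real.exp_one_lt_d9
    linarith

lemma exists_int_abs_le (x : ℝ) : ∃ k : ℤ, |(k : ℝ)| ≤ |x| ∧ |x - k| ≤ 1 := by
  rcases le_total 0 x with hx | hx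
  · refine ⟨⌊x⌋, ?_, ?_⟩
    · rw [abs_of_nonneg (by exact_mod_cast Int.floor_nonneg.2 hx), abs_of_nonneg hx]
      exact Int.floor_le x
    · rw [abs_le]
      constructor <;> linarith [Int.floor_le x, Int.lt_floor_add_one x]
  · refine ⟨⌈x⌉, ?_, ?_⟩
    · have : ⌈x⌉ ≤ 0 := Int.ceil_le.2 (by simpa using hx)
      rw [abs_of_nonpos (by exact_mod_cast this), abs_of_nonpos hx]
      linarith [Int.le_ceil x]
    · rw [abs_le]
      constructor <;> linarith [Int.le_ceil x, Int.ceil_lt_add_one x]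

/-- The point of the lattice `h ℤ^d` with the given integer coordinates. -/
noncomputable def latticePoint {d : ℕ} (h : ℝ) (z : Fin d → ℤ) : EuclideanSpace ℝ (Fin d) :=
  WithLp.toLp 2 fun i => h * z i

lemma exists_latticePoint_near {d : ℕ} (hd : 0 < d) {η : ℝ} (hη : 0 < η)
    {a : EuclideanSpace ℝ (Fin d)} (ha : ‖a‖ ≤ 1) :
    ∃ z : Fin d → ℤ, ∑ i, |(z i : ℝ)| ≤ d / η ∧ ‖latticePoint (η / √d) z‖ ≤ 1 ∧
      ‖a - latticePoint (η / √d) z‖ ≤ η := by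
  have hd' : (0 : ℝ) < d := by exact_mod_cast hd
  set h := η / √d
  have hh : 0 < h := by positivity
  choose z hz1 hz2 using fun i => exists_int_abs_le (a i / h)
  have hz3 : ∀ i, |h * z i| ≤ |a i| := fun i => by
    have := hz1 i
    rw [abs_div, abs_of_pos hh, le_div_iff₀ hh] at this
    rw [abs_mul, abs_of_pos hh]; linarith
  have hz4 : ∀ i, |a i - h * z i| ≤ h := fun i => by
    have h1 : a i - h * z i = h * (a i / h - z i) := by field_simp
    rw [h1, abs_mul, abs_of_pos hh]
    have := hz2 i
    nlinarith
  have hn2 : ∑ i, a i ^ 2 ≤ 1 := by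
    rw [← EuclideanSpace.real_norm_sq_eq]; exact pow_le_one₀ (norm_nonneg _) ha
  refine ⟨z, ?_, ?_, ?_⟩
  · have h1 : ∑ i, |(z i : ℝ)| ≤ (∑ i, |a i|) / h := by
      rw [Finset.sum_div]
      refine Finset.sum_le_sum fun i _ => (hz1 i).trans (le_of_eq ?_)
      rw [abs_div, abs_of_pos hh]
    have h2 : ∑ i, |a i| ≤ √d := by
      refine Real.le_sqrt_of_sq_le ?_
      have := sq_sum_le_card_mul_sum_sq (s := Finset.univ) (f := fun i => |a i|)
      simp only [sq_abs, Finset.card_univ, Fintype.card_fin] at this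
      nlinarith
    refine h1.trans ?_
    have h3 : (d : ℝ) / η = √d / h := by
      simp only [h]
      rw [div_div_eq_mul_div, Real.mul_self_sqrt hd'.le]
    rw [h3]
    gcongr
  · rw [← sq_le_one_iff₀ (norm_nonneg _), EuclideanSpace.real_norm_sq_eq]
    refine le_trans (Finset.sum_le_sum fun i _ => ?_) hn2
    exact sq_le_sq.2 (hz3 i)
  · rw [← sq_le_sq₀ (norm_nonneg _) hη.le, EuclideanSpace.real_norm_sq_eq]
    calc ∑ i, (a - latticePoint h z) i ^ 2 ≤ ∑ i : Fin d, h ^ 2 := by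
          refine Finset.sum_le_sum fun i _ => sq_le_sq.2 ?_
          rw [abs_of_pos hh]; exact hz4 i
      _ = η ^ 2 := by
          simp only [Finset.sum_const, Finset.card_univ, Fintype.card_fin, nsmul_eq_mul, h]
          rw [div_pow, Real.sq_sqrt hd'.le]; field_simp

/-- The matrix with rows `A i` has operator norm at most `8 √n`. -/
def OpBound {n d : ℕ} (A : Fin n → EuclideanSpace ℝ (Fin d)) : Prop :=
  ∀ a, ∑ i, ⟪a, A i⟫_ℝ ^ 2 ≤ 64 * n * ‖a‖ ^ 2

lemma OpBound.of_latticePoint {n d : ℕ} (hd : 0 < d) (A : Fin n → EuclideanSpace ℝ (Fin d))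
    (h : ∀ z : Fin d → ℤ, ∑ i, |(z i : ℝ)| ≤ d / (1 / 2 : ℝ) →
      ‖latticePoint ((1 / 2) / √d) z‖ ≤ 1 →
      ∑ i, ⟪latticePoint ((1 / 2) / √d) z, A i⟫_ℝ ^ 2 ≤ 16 * n) : OpBound A := by
  let T : EuclideanSpace ℝ (Fin d) →L[ℝ] EuclideanSpace ℝ (Fin n) :=
    LinearMap.toContinuousLinearMap
      { toFun := fun a => WithLp.toLp 2 fun i => ⟪a, A i⟫_ℝ
        map_add' := fun a b => by ext i; simp [inner_add_left]
        map_smul' := fun c a => by ext i; simp [inner_smul_left] }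
  have hT : ∀ a, ‖T a‖ ^ 2 = ∑ i, ⟪a, A i⟫_ℝ ^ 2 := fun a => by
    rw [EuclideanSpace.real_norm_sq_eq]; rfl
  have hbd : ∀ a : EuclideanSpace ℝ (Fin d), ‖a‖ ≤ 1 → ‖T a‖ ≤ 4 * √n + ‖T‖ / 2 := by
    intro a ha
    obtain ⟨z, hz1, hz2, hz3⟩ := exists_latticePoint_near hd (η := 1 / 2) (by norm_num) ha
    set b := latticePoint ((1 / 2) / √d) z
    have h1 : ‖T b‖ ≤ 4 * √n := by
      rw [← sq_le_sq₀ (norm_nonneg _) (by positivity), hT, mul_pow, Real.sq_sqrt (by positivity)]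
      linarith [h z hz1 hz2]
    have h2 : ‖T (a - b)‖ ≤ ‖T‖ * (1 / 2) := (T.le_opNorm _).trans (by gcongr)
    have h3 : T a = T b + T (a - b) := by rw [← map_add]; congr 1; abel
    rw [h3]
    refine (norm_add_le _ _).trans ?_
    linarith
  have hop : ‖T‖ ≤ 4 * √n + ‖T‖ / 2 :=
    T.opNorm_le_of_unit_norm (by positivity) fun a ha => hbd a ha.le
  intro a
  rw [← hT]
  have h1 : ‖T a‖ ≤ 8 * √n * ‖a‖ :=
    (T.le_opNorm a).trans (mul_le_mul_of_nonneg_right (by linarith) (norm_nonneg _))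
  calc ‖T a‖ ^ 2 ≤ (8 * √n * ‖a‖) ^ 2 := pow_le_pow_left₀ (norm_nonneg _) h1 2
    _ = 64 * n * ‖a‖ ^ 2 := by
        rw [mul_pow, mul_pow, Real.sq_sqrt (by positivity)]; norm_num

lemma pi_stdGaussian_real_le_sum_inner_sq {n d : ℕ} (hn : 0 < n)
    {a : EuclideanSpace ℝ (Fin d)} (ha : ‖a‖ ≤ 1) :
    (Measure.pi fun _ : Fin n => _root_.stdGaussian d).real
      {A | 16 * (n : ℝ) ≤ ∑ i, ⟪a, A i⟫_ℝ ^ 2} ≤ Real.exp (-(4 * n)) * √2 ^ n := by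
  have hn' : (0 : ℝ) < n := by exact_mod_cast hn
  rcases eq_or_ne a 0 with rfl | ha0
  · have : {A : Fin n → EuclideanSpace ℝ (Fin d) | 16 * (n : ℝ) ≤
        ∑ i, ⟪(0 : EuclideanSpace ℝ (Fin d)), A i⟫_ℝ ^ 2} = ∅ := by
      ext A; simp [hn]
    rw [this]; simp; positivity
  have hpos : 0 < ‖a‖ := norm_pos_iff.2 ha0
  set u := ‖a‖⁻¹ • a
  have hu : ‖u‖₊ = 1 := by ext; simp [u, norm_smul, hpos.ne']
  have hau : a = ‖a‖ • u := by simp [u, smul_smul, hpos.ne']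
  have h := pi_real_le_sum_le (ι := Fin n) (gaussianReal 0 1) (f := fun x => 1 / 4 * x ^ 2)
    (integrable_exp_sq_gaussianReal (by norm_num))
    (integral_exp_sq_gaussianReal (by norm_num)).le (4 * n)
  have h2 : (√(1 - 2 * (1 / 4) : ℝ))⁻¹ = √2 := by
    rw [← Real.sqrt_inv]; norm_num
  rw [h2, Fintype.card_fin] at h
  refine le_trans ?_ h
  have hlaw := map_inner_pi_stdGaussian (ι := Fin n) u
  rw [hu, one_pow] at hlaw
  rw [← hlaw, map_measureReal_apply (by fun_prop) (measurableSet_le (by fun_prop) (by fun_prop))]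
  refine measureReal_mono fun A hA => ?_
  simp only [Set.mem_ofPred_eq, Set.preimage_ofPred_eq] at hA ⊢
  rw [← Finset.mul_sum]
  have : ∑ i, ⟪a, A i⟫_ℝ ^ 2 ≤ ∑ i, ⟪u, A i⟫_ℝ ^ 2 := by
    refine Finset.sum_le_sum fun i _ => ?_
    conv_lhs => rw [hau]
    rw [real_inner_smul_left, mul_pow]
    have : ‖a‖ ^ 2 ≤ 1 := pow_le_one₀ (norm_nonneg _) ha
    nlinarith [sq_nonneg ⟪u, A i⟫_ℝ]
  linarith

lemma pi_stdGaussian_real_not_opBound_le {n d : ℕ} (hd : 0 < d) (hdn : d ≤ n) :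
    (Measure.pi fun _ : Fin n => _root_.stdGaussian d).real {A | ¬ OpBound A} ≤
      (1 / 2) ^ n := by
  obtain ⟨Z, hZ, hcard⟩ := exists_finset_int_card_le (Fin d) (η := 1 / 2) (by norm_num)
    (by norm_num)
  rw [Fintype.card_fin] at hZ hcard
  classical
  set μ := Measure.pi fun _ : Fin n => _root_.stdGaussian d
  set p : (Fin d → ℤ) → EuclideanSpace ℝ (Fin d) := fun z => latticePoint ((1 / 2) / √d) z
  set Z' := Z.filter (fun z => ‖p z‖ ≤ 1)
  have hsub : {A | ¬ OpBound A} ⊆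
      ⋃ z ∈ Z', {A : Fin n → EuclideanSpace ℝ (Fin d) |
        16 * (n : ℝ) ≤ ∑ i, ⟪p z, A i⟫_ℝ ^ 2} := by
    intro A hA
    by_contra hcon
    refine hA (OpBound.of_latticePoint hd A fun z hz1 hz2 => ?_)
    simp only [Set.mem_iUnion, not_exists, Set.mem_ofPred_eq, not_le] at hcon
    exact (hcon z (Finset.mem_filter.2 ⟨hZ z hz1, hz2⟩)).le
  refine (measureReal_mono hsub (measure_ne_top _ _)).trans
    ((measureReal_biUnion_finset_le _ _).trans ?_)
  refine (Finset.sum_le_sum fun z hz => pi_stdGaussian_real_le_sum_inner_sq (hd.trans_le hdn)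
    (Finset.mem_filter.1 hz).2).trans ?_
  rw [Finset.sum_const, nsmul_eq_mul]
  have h1 : (Z'.card : ℝ) ≤ 18 ^ n := by
    calc (Z'.card : ℝ) ≤ Z.card := by exact_mod_cast Finset.card_filter_le _ _
      _ ≤ 18 ^ d := hcard.trans (le_of_eq (by norm_num))
      _ ≤ 18 ^ n := pow_le_pow_right₀ (by norm_num) hdn
  have h2 : Real.exp (-(4 * n)) = (Real.exp (-4)) ^ n := by
    rw [← Real.exp_nat_mul]; congr 1; ring
  rw [h2]
  refine (mul_le_mul_of_nonneg_right h1 (by positivity)).trans ?_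
  rw [← mul_pow, ← mul_pow]
  refine pow_le_pow_left₀ (by positivity) ?_ _
  have h3 : √2 ≤ 1.5 := by rw [Real.sqrt_le_left (by norm_num)]; norm_num
  have h4 : Real.exp (-4) ≤ 1 / 54 := by
    rw [Real.exp_neg, ← one_div]
    refine one_div_le_one_div_of_le (by norm_num) ?_
    have : Real.exp 4 = Real.exp 1 ^ 4 := by rw [← Real.exp_nat_mul]; norm_num
    rw [this]
    calc (54 : ℝ) ≤ 2.718 ^ 4 := by norm_num
      _ ≤ _ := pow_le_pow_left₀ (by norm_num) (by linarith [Real.exp_one_gt_d9]) 4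
  have h5 := Real.exp_pos (-4)
  nlinarith [Real.sqrt_nonneg 2]

lemma OpBound.sum_abs_inner_le {n d : ℕ} {A : Fin n → EuclideanSpace ℝ (Fin d)}
    (hA : OpBound A) (a : EuclideanSpace ℝ (Fin d)) :
    ∑ i, |⟪a, A i⟫_ℝ| ≤ 8 * n * ‖a‖ := by
  refine abs_le_of_sq_le_sq' ?_ (by positivity) |>.2
  have h1 := sq_sum_le_card_mul_sum_sq (s := Finset.univ) (f := fun i => |⟪a, A i⟫_ℝ|)
  simp only [sq_abs, Finset.card_univ, Fintype.card_fin] at h1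
  have h2 := mul_le_mul_of_nonneg_left (hA a) (Nat.cast_nonneg (α := ℝ) n)
  nlinarith

lemma OpBound.norm_sum_smul_sq_le {n d : ℕ} {A : Fin n → EuclideanSpace ℝ (Fin d)}
    (hA : OpBound A) (v : Fin n → ℝ) :
    ‖∑ i, v i • A i‖ ^ 2 ≤ 64 * n * ∑ i, v i ^ 2 := by
  set w := ∑ i, v i • A i with hw
  rcases eq_or_ne w 0 with h0 | h0
  · rw [h0]; simp; positivity
  have hpos : 0 < ‖w‖ ^ 2 := by positivity
  have h1 : ‖w‖ ^ 2 = ∑ i, v i * ⟪w, A i⟫_ℝ := by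
    rw [← real_inner_self_eq_norm_sq]
    conv_lhs => rw [hw, inner_sum]
    simp only [← hw, real_inner_smul_right]
  have h2 := Finset.sum_mul_sq_le_sq_mul_sq Finset.univ v (fun i => ⟪w, A i⟫_ℝ)
  rw [← h1] at h2
  have h3 := mul_le_mul_of_nonneg_left (hA w)
    (Finset.sum_nonneg fun i (_ : i ∈ Finset.univ) => sq_nonneg (v i))
  refine le_of_mul_le_mul_right ?_ hpos
  nlinarith

lemma OpBound.norm_le {n d : ℕ} {A : Fin n → EuclideanSpace ℝ (Fin d)}
    (hA : OpBound A) (i : Fin n) : ‖A i‖ ^ 2 ≤ 64 * n := by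
  classical
  have h := hA.norm_sum_smul_sq_le (Pi.single i 1)
  simpa [Pi.single_apply, Finset.sum_ite_eq] using h

/-- The values of any linear functional at the points `A i` are spread out. -/
def SpreadBound {n d : ℕ} (r : ℝ) (A : Fin n → EuclideanSpace ℝ (Fin d)) : Prop :=
  ∀ a t, r * n * ‖a‖ ≤ ∑ i, |⟪a, A i⟫_ℝ - t|

lemma pi_stdGaussian_real_sum_abs_le {n d : ℕ} {r : ℝ} (hr : 0 < r)
    {a : EuclideanSpace ℝ (Fin d)} (ha : 1 / 2 ≤ ‖a‖) (t : ℝ) :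
    (Measure.pi fun _ : Fin n => _root_.stdGaussian d).real
      {A | ∑ i, |⟪a, A i⟫_ℝ - t| ≤ 3 * r * n} ≤ (36 * r) ^ n := by
  have hs : 0 < 1 / (3 * r) := by positivity
  have hv : ‖a‖₊ ^ 2 ≠ 0 := by
    refine pow_ne_zero _ fun h => ?_
    have : ‖a‖ = 0 := by simpa using congrArg NNReal.toReal h
    linarith
  have h := pi_real_le_sum_le (ι := Fin n) (gaussianReal 0 (‖a‖₊ ^ 2))
    (f := fun x => -(1 / (3 * r)) * |x - t|)
    (integrable_exp_neg_mul_abs_gaussianReal hs t)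
    (integral_exp_neg_mul_abs_gaussianReal_le hs t hv) (-n)
  rw [← map_inner_pi_stdGaussian, map_measureReal_apply (by fun_prop)
    (measurableSet_le (by fun_prop) (by fun_prop)), Fintype.card_fin, neg_neg] at h
  refine (measureReal_mono fun A hA => ?_).trans (h.trans ?_)
  · simp only [Set.mem_ofPred_eq, Set.preimage_ofPred_eq] at hA ⊢
    rw [← Finset.mul_sum, neg_mul, neg_le_neg_iff, one_div_mul_eq_div, div_le_iff₀ (by positivity)]
    linarith
  · rw [← Real.exp_one_pow, ← mul_pow]
    refine pow_le_pow_left₀ (by positivity) ?_ _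
    have h1 : √((‖a‖₊ ^ 2 : ℝ≥0) : ℝ) = ‖a‖ := by
      push_cast; rw [Real.sqrt_sq (norm_nonneg _)]
    have h2 : ‖a‖⁻¹ ≤ 2 := by
      rw [inv_le_comm₀ (by linarith) (by norm_num)]; linarith
    have h3 : 2 / (1 / (3 * r)) = 6 * r := by field_simp; norm_num
    rw [h1, h3]
    have h4 := Real.exp_one_lt_d9
    have h5 : ‖a‖⁻¹ * (6 * r) ≤ 2 * (6 * r) := by gcongr
    calc Real.exp 1 * (‖a‖⁻¹ * (6 * r)) ≤ 3 * (2 * (6 * r)) := by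
          gcongr; linarith
      _ = 36 * r := by ring

lemma pi_stdGaussian_real_not_spreadBound_le {n d : ℕ} (hd : 0 < d) {r : ℝ} (hr : 0 < r)
    (hr1 : r ≤ 1) :
    (Measure.pi fun _ : Fin n => _root_.stdGaussian d).real
      {A | OpBound A ∧ ¬ SpreadBound r A} ≤ (72 / r) ^ d * (19 / r) * (36 * r) ^ n := by
  obtain ⟨Z, hZ, hcard⟩ := exists_finset_int_card_le (Fin d) (η := r / 8) (by positivity)
    (by linarith)
  rw [Fintype.card_fin] at hZ hcard
  classical
  set p : (Fin d → ℤ) → EuclideanSpace ℝ (Fin d) := fun z => latticePoint ((r / 8) / √d) z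
  set Z' := Z.filter (fun z => 1 / 2 ≤ ‖p z‖)
  set K := ⌊9 / r⌋₊
  set I := Finset.Icc (-(K : ℤ)) K
  have hsub : {A | OpBound A ∧ ¬ SpreadBound r A} ⊆
      ⋃ q ∈ Z' ×ˢ I, {A : Fin n → EuclideanSpace ℝ (Fin d) |
        ∑ i, |⟪p q.1, A i⟫_ℝ - r * q.2| ≤ 3 * r * n} := by
    rintro A ⟨hA, hA2⟩
    simp only [SpreadBound, not_forall, not_le] at hA2
    obtain ⟨a, t, hat⟩ := hA2
    have hnn : 0 ≤ ∑ i, |⟪a, A i⟫_ℝ - t| := Finset.sum_nonneg fun _ _ => abs_nonneg _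
    have ha0 : a ≠ 0 := by rintro rfl; simp at hat; simp at hnn; linarith
    have hapos : 0 < ‖a‖ := norm_pos_iff.2 ha0
    have hn : (0 : ℝ) < n := by
      rcases Nat.eq_zero_or_pos n with rfl | h
      · simp at hat
      · exact_mod_cast h
    set u := ‖a‖⁻¹ • a
    have hu : ‖u‖ = 1 := by simp [u, norm_smul, hapos.ne']
    set τ := ‖a‖⁻¹ * t
    have hut : ∑ i, |⟪u, A i⟫_ℝ - τ| ≤ r * n := by
      have : ∀ i, |⟪u, A i⟫_ℝ - τ| = ‖a‖⁻¹ * |⟪a, A i⟫_ℝ - t| := fun i => by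
        simp only [u, τ]
        rw [real_inner_smul_left, ← mul_sub, abs_mul, abs_of_pos (inv_pos.2 hapos)]
      simp only [this]
      rw [← Finset.mul_sum, inv_mul_le_iff₀ hapos]
      linarith
    obtain ⟨z, hz1, -, hz3⟩ := exists_latticePoint_near hd (η := r / 8) (by positivity) hu.le
    have hτ : |τ| ≤ 9 := by
      have h1 : (n : ℝ) * |τ| ≤ ∑ i, (|⟪u, A i⟫_ℝ| + |⟪u, A i⟫_ℝ - τ|) := by
        calc (n : ℝ) * |τ| = ∑ i : Fin n, |τ| := by simp
          _ ≤ _ := Finset.sum_le_sum fun i _ => by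
            have := abs_sub_abs_le_abs_sub τ ⟪u, A i⟫_ℝ
            rw [abs_sub_comm τ] at this
            linarith
      rw [Finset.sum_add_distrib] at h1
      have h2 := hA.sum_abs_inner_le u
      rw [hu] at h2
      refine le_of_mul_le_mul_left (a := (n : ℝ)) ?_ hn
      nlinarith
    obtain ⟨k, hk1, hk2⟩ := exists_int_abs_le (τ / r)
    have hk3 : |τ - r * k| ≤ r := by
      have h1 : τ - r * k = r * (τ / r - k) := by field_simp
      rw [h1, abs_mul, abs_of_pos hr]
      nlinarith
    have hk4 : k ∈ I := by
      rw [abs_div, abs_of_pos hr] at hk1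
      have h2 : k.natAbs ≤ K := Nat.le_floor (by
        rw [Nat.cast_natAbs, Int.cast_abs]
        exact hk1.trans (by gcongr))
      rw [Finset.mem_Icc]; omega
    have hz4 : 1 / 2 ≤ ‖p z‖ := by
      have := norm_sub_norm_le u (p z)
      have h3 : ‖u - p z‖ ≤ r / 8 := hz3
      linarith
    simp only [Set.mem_iUnion]
    refine ⟨(z, k), Finset.mem_product.2 ⟨Finset.mem_filter.2 ⟨hZ z hz1, hz4⟩, hk4⟩, ?_⟩
    have h5 := hA.sum_abs_inner_le (u - p z)
    calc ∑ i, |⟪p z, A i⟫_ℝ - r * k|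
        ≤ ∑ i, (|⟪u - p z, A i⟫_ℝ| + |⟪u, A i⟫_ℝ - τ| + r) := by
          refine Finset.sum_le_sum fun i _ => ?_
          have h6 : ⟪p z, A i⟫_ℝ - r * k =
              -⟪u - p z, A i⟫_ℝ + (⟪u, A i⟫_ℝ - τ) + (τ - r * k) := by
            rw [inner_sub_left]; ring
          rw [h6]
          refine (abs_add_three _ _ _).trans ?_
          rw [abs_neg]; linarith
      _ ≤ 3 * r * n := by
          rw [Finset.sum_add_distrib, Finset.sum_add_distrib]
          simp only [Finset.sum_const, Finset.card_univ, Fintype.card_fin, nsmul_eq_mul]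
          have h7 : 8 * n * ‖u - p z‖ ≤ 8 * n * (r / 8) := by gcongr
          linarith
  refine (measureReal_mono hsub (measure_ne_top _ _)).trans
    ((measureReal_biUnion_finset_le _ _).trans ?_)
  refine (Finset.sum_le_sum fun q hq => pi_stdGaussian_real_sum_abs_le hr
    (Finset.mem_filter.1 (Finset.mem_product.1 hq).1).2 _).trans ?_
  rw [Finset.sum_const, nsmul_eq_mul, Finset.card_product]
  gcongr
  push_cast
  refine mul_le_mul ?_ ?_ (by positivity) (by positivity)
  · calc (Z'.card : ℝ) ≤ Z.card := by exact_mod_cast Finset.card_filter_le _ _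
      _ ≤ (72 / r) ^ d := hcard.trans (le_of_eq (by congr 1; field_simp; norm_num))
  · have h1 : (I.card : ℝ) = 2 * K + 1 := by
      have : I.card = 2 * K + 1 := by rw [Int.card_Icc]; omega
      rw [this]; push_cast; ring
    have h2 : (K : ℝ) ≤ 9 / r := Nat.floor_le (by positivity)
    have h3 : 1 ≤ 1 / r := by rw [le_div_iff₀ hr]; linarith
    have h4 : 19 / r = 2 * (9 / r) + 1 / r := by ring
    rw [h1, h4]; linarith

/-- The vector with entries `±1` on `S`, with signs given by `b`, and zero elsewhere. -/
def signVec {n : ℕ} (S : Finset (Fin n)) (b : Fin n → Bool) (i : Fin n) : ℝ :=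
  if i ∈ S then (if b i then 1 else -1) else 0

lemma abs_signVec_le {n : ℕ} (S : Finset (Fin n)) (b : Fin n → Bool) (i : Fin n) :
    |signVec S b i| ≤ 1 := by
  unfold signVec; split_ifs <;> simp

/-- Both `S` and its complement have at least `n / 4` elements. -/
def IsBalanced {n : ℕ} (S : Finset (Fin n)) : Prop :=
  (n : ℝ) / 4 ≤ S.card ∧ (n : ℝ) / 4 ≤ Sᶜ.card

lemma exists_isBalanced {n : ℕ} (hn : 2 ≤ n) : ∃ S : Finset (Fin n), IsBalanced S := by
  obtain ⟨S, -, hS⟩ := Finset.exists_subset_card_eq (s := (Finset.univ : Finset (Fin n)))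
    (n := n / 2) (by simp; omega)
  refine ⟨S, ?_, ?_⟩
  · rw [hS, div_le_iff₀ (by norm_num)]; norm_cast; omega
  · rw [Finset.card_compl, hS, Fintype.card_fin, div_le_iff₀ (by norm_num)]; norm_cast; omega

lemma IsBalanced.le_sum_abs_sub {n : ℕ} {S : Finset (Fin n)} (hS : IsBalanced S)
    (b : Fin n → Bool) (t : ℝ) : (n : ℝ) / 4 ≤ ∑ i, |signVec S b i - t| := by
  rw [← Finset.sum_add_sum_compl S]
  have h1 : ∀ i ∈ Sᶜ, |signVec S b i - t| = |t| := fun i hi => by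
    simp [signVec, Finset.mem_compl.1 hi]
  have h2 : ∀ i ∈ S, max 0 (1 - |t|) ≤ |signVec S b i - t| := fun i hi => by
    refine max_le (abs_nonneg _) ?_
    have h3 : |signVec S b i| = 1 := by
      simp only [signVec, hi, if_true]; split_ifs <;> simp
    have := abs_sub_abs_le_abs_sub (signVec S b i) t
    linarith
  rw [Finset.sum_congr rfl h1]
  have h3 := Finset.sum_le_sum h2
  rw [Finset.sum_const, nsmul_eq_mul] at h3 ⊢
  have h4 : (n : ℝ) / 4 * max 0 (1 - |t|) ≤ S.card * max 0 (1 - |t|) := by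
    gcongr; exact hS.1
  have h5 : (n : ℝ) / 4 * |t| ≤ Sᶜ.card * |t| := by gcongr; exact hS.2
  have h6 : (n : ℝ) / 4 * (1 - |t|) ≤ n / 4 * max 0 (1 - |t|) := by
    gcongr; exact le_max_right _ _
  linarith

/-- No signed combination of the centred points lies in `c n` times their convex hull. -/
def AvoidBound {n d : ℕ} (c : ℝ) (S : Finset (Fin n)) (A : Fin n → EuclideanSpace ℝ (Fin d)) :
    Prop :=
  ∀ b, ∀ l : Fin n → ℝ, (∀ i, 0 ≤ l i) → ∑ i, l i = c * n →
    ∑ i, (l i - signVec S b i - (c - (∑ j, signVec S b j) / n)) • A i ≠ 0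

lemma pi_stdGaussian_real_not_avoidBound_le {n d : ℕ} (hn : 0 < n) {c : ℝ} (hc : 0 < c)
    (hc1 : c ≤ 1 / 8) {S : Finset (Fin n)} (hS : IsBalanced S) :
    (Measure.pi fun _ : Fin n => _root_.stdGaussian d).real
      {A | OpBound A ∧ ¬ AvoidBound c S A} ≤
      2 ^ n * 9 ^ n * (Real.exp (n / 2) * (64 * c) ^ d) := by
  have hn' : (0 : ℝ) < n := by exact_mod_cast hn
  obtain ⟨Z, hZ, hcard⟩ := exists_finset_int_card_le (Fin n) (η := 1) (by norm_num) le_rfl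
  rw [Fintype.card_fin, div_one] at hZ hcard
  classical
  set Z' := Z.filter (fun z => ∑ i, |(z i : ℝ)| ≤ n)
  set v : (Fin n → Bool) × (Fin n → ℤ) → Fin n → ℝ := fun q i =>
    c * q.2 i - signVec S q.1 i - (c - (∑ j, signVec S q.1 j) / n)
  have hsub : {A | OpBound A ∧ ¬ AvoidBound c S A} ⊆
      ⋃ q ∈ (Finset.univ : Finset (Fin n → Bool)) ×ˢ Z',
        {A : Fin n → EuclideanSpace ℝ (Fin d) |
          ‖∑ i, v q i • A i‖ ^ 2 ≤ (n : ℝ) / 64 * (4096 * c ^ 2 * n)} := by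
    rintro A ⟨hA, hA2⟩
    simp only [AvoidBound, not_forall, not_not, ne_eq] at hA2
    obtain ⟨b, l, hl0, hl1, hl⟩ := hA2
    set z : Fin n → ℤ := fun i => ⌊l i / c⌋
    have hz0 : ∀ i, 0 ≤ (z i : ℝ) := fun i => by
      exact_mod_cast Int.floor_nonneg.2 (div_nonneg (hl0 i) hc.le)
    have hz1 : ∀ i, c * z i ≤ l i := fun i => by
      have := Int.floor_le (l i / c)
      rw [le_div_iff₀ hc] at this; linarith
    have hz2 : ∀ i, l i - c * z i ≤ c := fun i => by
      have := (Int.lt_floor_add_one (l i / c)).le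
      rw [div_le_iff₀ hc] at this
      have : l i ≤ ((z i : ℝ) + 1) * c := this
      linarith
    have hz3 : ∑ i, |(z i : ℝ)| ≤ n := by
      simp only [abs_of_nonneg (hz0 _)]
      refine le_of_mul_le_mul_left (a := c) ?_ hc
      rw [Finset.mul_sum, ← hl1]
      exact Finset.sum_le_sum fun i _ => hz1 i
    simp only [Set.mem_iUnion]
    refine ⟨(b, z), Finset.mem_product.2 ⟨Finset.mem_univ _, Finset.mem_filter.2 ⟨hZ z hz3, hz3⟩⟩,
      ?_⟩
    have h1 : ∑ i, v (b, z) i • A i = ∑ i, (c * z i - l i) • A i := by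
      rw [← sub_eq_zero, ← Finset.sum_sub_distrib, ← hl]
      refine Finset.sum_congr rfl fun i _ => ?_
      simp only [v]
      rw [← sub_smul]; congr 1; ring
    rw [Set.mem_ofPred_eq, h1]
    refine (hA.norm_sum_smul_sq_le _).trans ?_
    have h2 : ∑ i, (c * z i - l i) ^ 2 ≤ n * c ^ 2 := by
      calc ∑ i, (c * z i - l i) ^ 2 ≤ ∑ i : Fin n, c ^ 2 := by
            refine Finset.sum_le_sum fun i _ => sq_le_sq.2 ?_
            rw [abs_of_pos hc, abs_le]
            constructor <;> linarith [hz1 i, hz2 i]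
        _ = n * c ^ 2 := by simp
    nlinarith
  have hv : ∀ q ∈ (Finset.univ : Finset (Fin n → Bool)) ×ˢ Z', (n : ℝ) / 64 ≤ ∑ i, v q i ^ 2 := by
    rintro ⟨b, z⟩ hq
    have hz : ∑ i, |(z i : ℝ)| ≤ n := (Finset.mem_filter.1 (Finset.mem_product.1 hq).2).2
    have h1 := hS.le_sum_abs_sub b (-(c - (∑ j, signVec S b j) / n))
    have h2 : ∑ i, |signVec S b i - -(c - (∑ j, signVec S b j) / n)| ≤
        ∑ i, (|v (b, z) i| + c * |(z i : ℝ)|) := by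
      refine Finset.sum_le_sum fun i _ => ?_
      have : signVec S b i - -(c - (∑ j, signVec S b j) / n) = -v (b, z) i + c * z i := by
        simp only [v]; ring
      rw [this]
      refine (abs_add_le _ _).trans ?_
      rw [abs_neg, abs_mul, abs_of_pos hc]
    rw [Finset.sum_add_distrib, ← Finset.mul_sum] at h2
    have h3 : (n : ℝ) / 8 ≤ ∑ i, |v (b, z) i| := by nlinarith
    have h4 := sq_sum_le_card_mul_sum_sq (s := Finset.univ) (f := fun i => |v (b, z) i|)
    simp only [sq_abs, Finset.card_univ, Fintype.card_fin] at h4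
    refine le_of_mul_le_mul_left (a := (n : ℝ)) ?_ hn'
    have h5 := pow_le_pow_left₀ (by positivity) h3 2
    nlinarith
  refine (measureReal_mono hsub (measure_ne_top _ _)).trans
    ((measureReal_biUnion_finset_le _ _).trans ?_)
  refine (Finset.sum_le_sum fun q hq => pi_stdGaussian_real_norm_sum_le d (v q) (hv q hq)
    (by positivity) (s := 1 / (8192 * c ^ 2)) (by positivity) _).trans ?_
  rw [Finset.sum_const, nsmul_eq_mul, Finset.card_product]
  push_cast
  refine mul_le_mul ?_ ?_ (by positivity) (by positivity)
  · rw [Finset.card_univ, Fintype.card_fun, Fintype.card_bool, Fintype.card_fin]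
    push_cast
    gcongr
    calc (Z'.card : ℝ) ≤ Z.card := by exact_mod_cast Finset.card_filter_le _ _
      _ ≤ 9 ^ n := hcard.trans (le_of_eq (by norm_num))
  · refine mul_le_mul (le_of_eq ?_) ?_ (by positivity) (by positivity)
    · congr 1; field_simp; norm_num
    · refine pow_le_pow_left₀ (by positivity) ?_ _
      rw [← Real.sqrt_inv, Real.sqrt_le_left (by positivity),
        inv_le_comm₀ (by positivity) (by positivity)]
      have : ((64 * c) ^ 2)⁻¹ = 2 * (1 / (8192 * c ^ 2)) := by field_simp; norm_num
      rw [this]; linarith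

/-- The point configuration satisfies all the regularity conditions needed below. -/
structure IsGood {n d : ℕ} (r c : ℝ) (S : Finset (Fin n)) (A : Fin n → EuclideanSpace ℝ (Fin d)) :
    Prop where
  opBound : OpBound A
  spread : SpreadBound r A
  avoid : AvoidBound c S A

lemma exists_pi_stdGaussian_real_not_isGood_le {δ : ℝ} (hδ0 : 0 < δ) (hδ1 : δ < 1) :
    ∃ r c : ℝ, 0 < r ∧ r ≤ 1 ∧ 0 < c ∧ c ≤ 1 / 8 ∧ ∀ n d : ℕ, 0 < d → (d : ℝ) ≤ δ * n →
      δ * n / 2 ≤ d → ∀ S : Finset (Fin n), IsBalanced S →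
      (Measure.pi fun _ : Fin n => _root_.stdGaussian d).real {A | ¬ IsGood r c S A} ≤
        (2 + 19 / r) * (1 / 2) ^ n := by
  set r : ℝ := (1 / 5184 : ℝ) ^ (1 / (1 - δ))
  set e : ℝ := (1 / 72 : ℝ) ^ (2 / δ)
  have hr : 0 < r := by positivity
  have he : 0 < e := by positivity
  have hδ' : 0 < 1 - δ := by linarith
  have hr1 : r ≤ 1 := Real.rpow_le_one (by norm_num) (by norm_num) (by positivity)
  have he1 : e ≤ 1 := Real.rpow_le_one (by norm_num) (by norm_num) (by positivity)
  have hr2 : r ^ (1 - δ) = 1 / 5184 := by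
    simp only [r]
    rw [← Real.rpow_mul (by norm_num), one_div_mul_cancel hδ'.ne', Real.rpow_one]
  have he2 : e ^ (δ / 2) = 1 / 72 := by
    simp only [e]
    rw [← Real.rpow_mul (by norm_num), div_mul_div_cancel₀ hδ0.ne', div_self (by norm_num),
      Real.rpow_one]
  refine ⟨r, e / 64, hr, hr1, by positivity, by linarith, fun n d hd hdn hnd S hS => ?_⟩
  have hn : 0 < n := by
    rcases Nat.eq_zero_or_pos n with rfl | h
    · simp at hdn; omega
    · exact h
  have hdn' : d ≤ n := by
    have : (d : ℝ) ≤ n := hdn.trans (by nlinarith [Nat.cast_nonneg (α := ℝ) n])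
    exact_mod_cast this
  have h1 := pi_stdGaussian_real_not_opBound_le hd hdn'
  have h2 := pi_stdGaussian_real_not_spreadBound_le (n := n) hd hr hr1
  have h3 := pi_stdGaussian_real_not_avoidBound_le (d := d) hn (c := e / 64) (by positivity)
    (by linarith) hS
  have h4 : (72 / r) ^ d * (19 / r) * (36 * r) ^ n ≤ 19 / r * (1 / 2) ^ n := by
    have h5 : (72 / r) ^ d ≤ ((72 / r) ^ δ) ^ n := by
      rw [← Real.rpow_natCast, ← Real.rpow_natCast, ← Real.rpow_mul (by positivity)]
      exact Real.rpow_le_rpow_of_exponent_le (by rw [le_div_iff₀ hr]; linarith) hdn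
    have h6 : (72 / r) ^ δ * (36 * r) ≤ 1 / 2 := by
      have h7 : (72 : ℝ) ^ δ ≤ 72 := by
        calc (72 : ℝ) ^ δ ≤ 72 ^ (1 : ℝ) :=
              Real.rpow_le_rpow_of_exponent_le (by norm_num) hδ1.le
          _ = 72 := Real.rpow_one _
      have h8 : r ^ (1 - δ) = r / r ^ δ := by rw [Real.rpow_sub hr, Real.rpow_one]
      rw [Real.div_rpow (by norm_num) hr.le]
      calc (72 : ℝ) ^ δ / r ^ δ * (36 * r) = 72 ^ δ * 36 * (r / r ^ δ) := by ring
        _ ≤ 72 * 36 * (1 / 5184) := by rw [← h8, hr2]; gcongr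
        _ = 1 / 2 := by norm_num
    calc (72 / r) ^ d * (19 / r) * (36 * r) ^ n
        ≤ ((72 / r) ^ δ) ^ n * (19 / r) * (36 * r) ^ n := by gcongr
      _ = 19 / r * ((72 / r) ^ δ * (36 * r)) ^ n := by rw [mul_pow]; ring
      _ ≤ _ := by gcongr
  have h5 : 2 ^ n * 9 ^ n * (Real.exp (n / 2) * (64 * (e / 64)) ^ d) ≤ (1 / 2) ^ n := by
    have h6 : (64 * (e / 64)) ^ d ≤ (1 / 72 : ℝ) ^ n := by
      rw [mul_div_cancel₀ _ (by norm_num), ← he2, ← Real.rpow_natCast, ← Real.rpow_natCast,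
        ← Real.rpow_mul he.le]
      exact Real.rpow_le_rpow_of_exponent_ge he he1 (by linarith)
    have h7 : Real.exp ((n : ℝ) / 2) ≤ 2 ^ n := by
      have h8 : Real.exp ((n : ℝ) / 2) = Real.exp (1 / 2) ^ n := by
        rw [← Real.exp_nat_mul]; congr 1; ring
      rw [h8]
      refine pow_le_pow_left₀ (Real.exp_pos _).le ?_ _
      have h9 : Real.exp (1 / 2) ^ 2 = Real.exp 1 := by rw [← Real.exp_nat_mul]; norm_num
      have := Real.exp_one_lt_d9
      nlinarith [Real.exp_pos (1 / 2)]
    calc 2 ^ n * 9 ^ n * (Real.exp (n / 2) * (64 * (e / 64)) ^ d)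
        ≤ 2 ^ n * 9 ^ n * (2 ^ n * (1 / 72) ^ n) := by gcongr
      _ = (1 / 2) ^ n := by rw [← mul_pow, ← mul_pow, ← mul_pow]; norm_num
  have hsub : {A : Fin n → EuclideanSpace ℝ (Fin d) | ¬ IsGood r (e / 64) S A} ⊆
      {A | ¬ OpBound A} ∪ {A | OpBound A ∧ ¬ SpreadBound r A} ∪
        {A | OpBound A ∧ ¬ AvoidBound (e / 64) S A} := by
    intro A hA
    by_contra hcon
    simp only [Set.mem_union, Set.mem_ofPred_eq, not_or, not_and, not_not] at hcon
    exact hA ⟨hcon.1.1, hcon.1.2 hcon.1.1, hcon.2 hcon.1.1⟩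
  refine (measureReal_mono hsub (measure_ne_top _ _)).trans ((measureReal_union_le _ _).trans ?_)
  have := measureReal_union_le (μ := Measure.pi fun _ : Fin n => _root_.stdGaussian d)
    {A | ¬ OpBound A} {A | OpBound A ∧ ¬ SpreadBound r A}
  linarith

lemma exists_weights_of_mem_convexHull_range {ι E : Type*} [Fintype ι] [AddCommGroup E]
    [Module ℝ E] {B : ι → E} {y : E} (hy : y ∈ convexHull ℝ (Set.range B)) :
    ∃ w : ι → ℝ, (∀ i, 0 ≤ w i) ∧ ∑ i, w i = 1 ∧ ∑ i, w i • B i = y := by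
  classical
  have h : convexHull ℝ (Set.range B) ⊆ Fintype.linearCombination ℝ B '' stdSimplex ℝ ι := by
    refine convexHull_min ?_ ((convex_stdSimplex ℝ ι).linear_image _)
    rintro _ ⟨i, rfl⟩
    exact ⟨Pi.single i 1, single_mem_stdSimplex ℝ i, by simp⟩
  obtain ⟨w, hw, rfl⟩ := h hy
  exact ⟨w, hw.1, hw.2, by simp [Fintype.linearCombination_apply]⟩

lemma mem_extremePoints_convexHull_insert {E : Type*} [AddCommGroup E] [Module ℝ E] {s : Set E}
    (hs : s.Nonempty) {x : E} (hx : x ∉ convexHull ℝ s) :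
    x ∈ (convexHull ℝ (insert x s)).extremePoints ℝ := by
  refine mem_extremePoints_iff_left.2
    ⟨subset_convexHull _ _ (Set.mem_insert _ _), fun x₁ h₁ x₂ h₂ h => ?_⟩
  simp only [convexHull_insert hs, mem_convexJoin, Set.mem_singleton_iff, exists_eq_left] at h₁ h₂
  obtain ⟨y₁, hy₁, p', p, hp', hp, hpp, rfl⟩ := h₁
  obtain ⟨y₂, hy₂, q', q, hq', hq, hqq, rfl⟩ := h₂
  obtain ⟨α, β, hα, hβ, hαβ, hxe⟩ := h
  have hcomb : (α * p + β * q) • x = (α * p) • y₁ + (β * q) • y₂ := by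
    have h1 : p' = 1 - p := by linarith
    have h2 : q' = 1 - q := by linarith
    have h3 : β = 1 - α := by linarith
    subst h1 h2 h3
    have : (α * p + (1 - α) * q) • x - ((α * p) • y₁ + ((1 - α) * q) • y₂) =
        x - (α • ((1 - p) • x + p • y₁) + (1 - α) • ((1 - q) • x + q • y₂)) := by module
    rw [hxe, sub_self] at this
    exact sub_eq_zero.1 this
  rcases (add_nonneg (mul_nonneg hα.le hp) (mul_nonneg hβ.le hq)).eq_or_lt with h0 | h0
  · have hp0 : p = 0 := by
      have := mul_nonneg hα.le hp
      have := mul_nonneg hβ.le hq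
      have h3 : α * p = 0 := by linarith
      exact (mul_eq_zero.1 h3).resolve_left hα.ne'
    have : p' = 1 := by linarith
    simp [hp0, this]
  · refine absurd ?_ hx
    have h4 : x = (α * p / (α * p + β * q)) • y₁ + (β * q / (α * p + β * q)) • y₂ := by
      rw [div_eq_inv_mul, div_eq_inv_mul, mul_smul _ (α * p), mul_smul _ (β * q),
        ← smul_add, ← hcomb, smul_smul,
        inv_mul_cancel₀ h0.ne', one_smul]
    rw [h4]
    exact convex_convexHull ℝ s hy₁ hy₂ (by positivity) (by positivity)
      (by rw [← add_div, div_self h0.ne'])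

/-- At an extreme point of a polyhedron the active constraints span the whole space. -/
lemma span_active_eq_top_of_mem_extremePoints {ι E : Type*} [Finite ι] [NormedAddCommGroup E]
    [InnerProductSpace ℝ E] [FiniteDimensional ℝ E] {B : ι → E} {a : E}
    (ha : a ∈ {a : E | ∀ i, ⟪B i, a⟫_ℝ ≤ 1}.extremePoints ℝ) :
    Submodule.span ℝ {v | ∃ i, v = B i ∧ ⟪B i, a⟫_ℝ = 1} = ⊤ := by
  by_contra hne
  set W := Submodule.span ℝ {v | ∃ i, v = B i ∧ ⟪B i, a⟫_ℝ = 1}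
  obtain ⟨w, hw, hw0⟩ := Submodule.exists_mem_ne_zero_of_ne_bot
    (mt Submodule.orthogonal_eq_bot_iff.1 hne)
  have haQ : ∀ i, ⟪B i, a⟫_ℝ ≤ 1 := ha.1
  have hact : ∀ i, ⟪B i, a⟫_ℝ = 1 → ⟪B i, w⟫_ℝ = 0 := fun i hi =>
    (Submodule.mem_orthogonal W w).1 hw _ (Submodule.subset_span ⟨i, rfl, hi⟩)
  have hev : ∀ s : ℝ, ∀ᶠ e : ℝ in nhds 0, ∀ i, ⟪B i, a + (s * e) • w⟫_ℝ ≤ 1 := by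
    intro s
    refine Filter.eventually_all.2 fun i => ?_
    rcases (haQ i).eq_or_lt with hi | hi
    · refine Filter.Eventually.of_forall fun e => ?_
      rw [inner_add_right, real_inner_smul_right, hact i hi, mul_zero, add_zero, hi]
    · have hc : Continuous fun e : ℝ => ⟪B i, a + (s * e) • w⟫_ℝ := by fun_prop
      have h2 := hc.continuousAt.eventually_lt (x₀ := 0) (g := fun _ => (1 : ℝ))
        continuousAt_const (by simpa using hi)
      exact h2.mono fun e he => he.le
  obtain ⟨e, ⟨he1, he2⟩, he0⟩ := (((hev 1).and (hev (-1))).filter_mono nhdsWithin_le_nhds).and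
    (self_mem_nhdsWithin (a := (0 : ℝ)) (s := Set.Ioi 0)) |>.exists
  have he0' : (0 : ℝ) < e := he0
  have h := (mem_extremePoints_iff_left.1 ha).2 _ he1 _ he2
    ⟨1 / 2, 1 / 2, by norm_num, by norm_num, by norm_num, by module⟩
  rw [add_eq_left, smul_eq_zero] at h
  rcases h with h | h
  · linarith
  · exact hw0 h

/-- A linear functional on a compact set attains its maximum at an extreme point. -/
lemma IsCompact.exists_extremePoint_le_inner {E : Type*} [NormedAddCommGroup E]
    [InnerProductSpace ℝ E] {Q : Set E} (hQ : IsCompact Q) {a₀ : E} (ha₀ : a₀ ∈ Q) (θ : E) :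
    ∃ a ∈ Q.extremePoints ℝ, ⟪θ, a₀⟫_ℝ ≤ ⟪θ, a⟫_ℝ := by
  obtain ⟨a₁, ha₁, hmax⟩ := hQ.exists_isMaxOn ⟨a₀, ha₀⟩
    (f := fun a => ⟪θ, a⟫_ℝ) (by fun_prop)
  set F : Set E := {a ∈ Q | ∀ y ∈ Q, innerSL ℝ θ y ≤ innerSL ℝ θ a}
  have hF : IsExposed ℝ Q F := fun _ => ⟨innerSL ℝ θ, rfl⟩
  obtain ⟨a, ha⟩ := (hF.isCompact hQ).extremePoints_nonempty ⟨a₁, ha₁, fun y hy => hmax hy⟩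
  exact ⟨a, hF.isExtreme.extremePoints_subset_extremePoints ha, ha.1.2 a₀ ha₀⟩

lemma vf_le_of_span_active {n d : ℕ} {A : Fin n → EuclideanSpace ℝ (Fin d)}
    {x m a : EuclideanSpace ℝ (Fin d)} {ε : ℝ} (h : ∀ i, ⟪A i - m, a⟫_ℝ ≤ 1)
    (hspan : Submodule.span ℝ {v | ∃ i, v = A i - m ∧ ⟪A i - m, a⟫_ℝ = 1} = ⊤) (ha : a ≠ 0)
    (hx : x ∉ convexHull ℝ (Set.range A)) (hx1 : ⟪x - m, a⟫_ℝ < 1)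
    (hx2 : 1 - ε * ‖a‖ ≤ ⟪x - m, a⟫_ℝ) :
    vf (convexHull ℝ (insert x (Set.range A))) ≤ ε := by
  set P := convexHull ℝ (insert x (Set.range A))
  set F : Set (EuclideanSpace ℝ (Fin d)) := {y ∈ P | ∀ z ∈ P, innerSL ℝ a z ≤ innerSL ℝ a y}
  have hapos : 0 < ‖a‖ := norm_pos_iff.2 ha
  have hP : ∀ y ∈ P, ⟪y - m, a⟫_ℝ ≤ 1 := by
    have hconv : Convex ℝ {y : EuclideanSpace ℝ (Fin d) | innerSL ℝ a y ≤ 1 + ⟪a, m⟫_ℝ} :=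
      convex_halfSpace_le (innerSL ℝ a).toLinearMap.isLinear _
    have hsub : P ⊆ {y : EuclideanSpace ℝ (Fin d) | innerSL ℝ a y ≤ 1 + ⟪a, m⟫_ℝ} := by
      refine convexHull_min ?_ hconv
      rintro y (rfl | ⟨i, rfl⟩)
      · rw [real_inner_comm, inner_sub_right] at hx1
        simp only [Set.mem_ofPred_eq, innerSL_apply_apply]; linarith
      · have := h i
        rw [real_inner_comm, inner_sub_right] at this
        simp only [Set.mem_ofPred_eq, innerSL_apply_apply]; linarith
    intro y hy
    have := hsub hy
    simp only [Set.mem_ofPred_eq, innerSL_apply_apply] at this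
    rw [real_inner_comm, inner_sub_right]; linarith
  have hAP : ∀ i, A i ∈ P := fun i => subset_convexHull _ _ (Or.inr ⟨i, rfl⟩)
  have hxP : x ∈ P := subset_convexHull _ _ (Or.inl rfl)
  obtain ⟨i₀, hi₀⟩ : ∃ i, ⟪A i - m, a⟫_ℝ = 1 := by
    by_contra hcon
    have : {v | ∃ i, v = A i - m ∧ ⟪A i - m, a⟫_ℝ = 1} = ∅ := by
      ext v; simp only [Set.mem_ofPred_eq, Set.mem_empty_iff_false, iff_false]
      rintro ⟨i, -, hi⟩; exact hcon ⟨i, hi⟩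
    rw [this, Submodule.span_empty] at hspan
    have ha' : a ∈ (⊥ : Submodule ℝ (EuclideanSpace ℝ (Fin d))) := hspan ▸ Submodule.mem_top
    exact ha ((Submodule.mem_bot ℝ).1 ha')
  have hAF : ∀ i, ⟪A i - m, a⟫_ℝ = 1 → A i ∈ F := fun i hi => ⟨hAP i, fun z hz => by
    have := hP z hz
    rw [real_inner_comm, inner_sub_right] at this hi
    simp only [innerSL_apply_apply]; linarith⟩
  have hFeq : ∀ y ∈ F, ⟪a, y⟫_ℝ = 1 + ⟪a, m⟫_ℝ := by
    rintro y ⟨hy, hy2⟩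
    have h1 := hP y hy
    have h2 := hy2 _ (hAP i₀)
    have h3 := hi₀
    rw [real_inner_comm, inner_sub_right] at h1 h3
    simp only [innerSL_apply_apply] at h2
    linarith
  have hxF : x ∉ F := fun hxF => by
    have := hFeq x hxF
    rw [real_inner_comm, inner_sub_right] at hx1
    linarith
  set D := (affineSpan ℝ F).direction with hD
  have hDa : ∀ w ∈ D, ⟪a, w⟫_ℝ = 0 := by
    intro w hw
    have : D ≤ (ℝ ∙ a)ᗮ := by
      rw [hD, direction_affineSpan, vectorSpan_def, Submodule.span_le]
      rintro _ ⟨y, hy, z, hz, rfl⟩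
      rw [SetLike.mem_coe, Submodule.mem_orthogonal_singleton_iff_inner_right]
      simp only [vsub_eq_sub, inner_sub_right, hFeq y hy, hFeq z hz, sub_self]
    exact (Submodule.mem_orthogonal_singleton_iff_inner_right).1 (this hw)
  have hDtop : D ⊔ (ℝ ∙ (A i₀ - m)) = ⊤ := by
    rw [eq_top_iff, ← hspan, Submodule.span_le]
    rintro _ ⟨i, rfl, hi⟩
    have h1 : A i - A i₀ ∈ D := by
      rw [hD, direction_affineSpan]
      exact vsub_mem_vectorSpan ℝ (hAF i hi) (hAF i₀ hi₀)
    have h2 : A i - m = (A i - A i₀) + (A i₀ - m) := by abel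
    rw [h2]
    exact Submodule.add_mem_sup h1 (Submodule.mem_span_singleton_self _)
  have hDmem : ∀ w, ⟪a, w⟫_ℝ = 0 → w ∈ D := by
    intro w hw
    have hw' : w ∈ D ⊔ (ℝ ∙ (A i₀ - m)) := hDtop ▸ Submodule.mem_top
    obtain ⟨w₁, hw₁, w₂, hw₂, rfl⟩ := Submodule.mem_sup.1 hw'
    obtain ⟨k, rfl⟩ := Submodule.mem_span_singleton.1 hw₂
    rw [inner_add_right, hDa w₁ hw₁, real_inner_smul_right, real_inner_comm, hi₀] at hw
    have : k = 0 := by linarith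
    simpa [this] using hw₁
  have hfacet : IsFacetOf P F := by
    refine ⟨fun _ => ⟨innerSL ℝ a, rfl⟩, ⟨A i₀, hAF i₀ hi₀⟩, ?_⟩
    have hlt : D < (affineSpan ℝ P).direction := by
      refine lt_of_le_of_ne (AffineSubspace.direction_le (affineSpan_mono ℝ fun y hy => hy.1)) ?_
      intro heq
      have h1 : x - A i₀ ∈ D := by
        rw [heq, direction_affineSpan]
        exact vsub_mem_vectorSpan ℝ hxP (hAP i₀)
      have h2 := hDa _ h1
      have h3 := hi₀
      rw [real_inner_comm, inner_sub_right] at hx1 h3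
      rw [inner_sub_right] at h2
      linarith
    have h1 := Submodule.finrank_lt_finrank_of_lt hlt
    have h2 := Submodule.finrank_add_le_finrank_add_finrank D (ℝ ∙ (A i₀ - m))
    rw [hDtop, finrank_top] at h2
    have h3 := finrank_span_singleton (K := ℝ) (v := A i₀ - m) (fun h0 => by simp [h0] at hi₀)
    have h4 := Submodule.finrank_le (affineSpan ℝ P).direction
    rw [← hD]
    omega
  have hnn : ∀ F : Set (EuclideanSpace ℝ (Fin d)),
      ∀ s ∈ {s : ℝ | ∃ v ∈ Set.extremePoints ℝ P, v ∉ F ∧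
        s = Metric.infDist v (affineSpan ℝ F : Set (EuclideanSpace ℝ (Fin d)))}, 0 ≤ s := by
    rintro F _ ⟨v, -, -, rfl⟩; exact Metric.infDist_nonneg
  have hvert : x ∈ P.extremePoints ℝ :=
    mem_extremePoints_convexHull_insert (s := Set.range A) ⟨A i₀, i₀, rfl⟩ hx
  have hvf : vf P ≤ sInf {s : ℝ | ∃ v ∈ Set.extremePoints ℝ P, v ∉ F ∧
      s = Metric.infDist v (affineSpan ℝ F : Set (EuclideanSpace ℝ (Fin d)))} := by
    refine csInf_le ⟨0, ?_⟩ ⟨F, hfacet, rfl⟩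
    rintro _ ⟨F', -, rfl⟩
    exact Real.sInf_nonneg (hnn F')
  refine hvf.trans ((csInf_le ⟨0, fun s hs => hnn F s hs⟩ ⟨x, hvert, hxF, rfl⟩).trans ?_)
  set k := (1 - ⟪x - m, a⟫_ℝ) / ‖a‖ ^ 2
  have hk : 0 ≤ k := div_nonneg (by linarith) (by positivity)
  have hy : x + k • a ∈ affineSpan ℝ F := by
    have h1 : x + k • a - A i₀ ∈ D := by
      refine hDmem _ ?_
      have h3 := hi₀
      rw [inner_sub_right, inner_add_right, real_inner_smul_right, real_inner_self_eq_norm_sq,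
        div_mul_cancel₀ _ (by positivity), real_inner_comm, inner_sub_left,
        real_inner_comm (A i₀) a]
      rw [inner_sub_left] at h3
      linarith
    have h2 := AffineSubspace.vadd_mem_of_mem_direction h1
      (mem_affineSpan ℝ (hAF i₀ hi₀))
    simpa using h2
  refine (Metric.infDist_le_dist_of_mem hy).trans ?_
  rw [dist_eq_norm, sub_add_cancel_left, norm_neg, norm_smul, Real.norm_of_nonneg hk]
  have : k * ‖a‖ = (1 - ⟪x - m, a⟫_ℝ) / ‖a‖ := by simp only [k]; field_simp
  rw [this, div_le_iff₀ hapos]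
  linarith

/-- The average of the points `A i`. -/
noncomputable def sampleMean {n d : ℕ} (A : Fin n → EuclideanSpace ℝ (Fin d)) :
    EuclideanSpace ℝ (Fin d) := (n : ℝ)⁻¹ • ∑ i, A i

lemma sum_sub_sampleMean {n d : ℕ} (hn : 0 < n) (A : Fin n → EuclideanSpace ℝ (Fin d)) :
    ∑ i, (A i - sampleMean A) = 0 := by
  have : (n : ℝ) ≠ 0 := by exact_mod_cast hn.ne'
  rw [Finset.sum_sub_distrib, Finset.sum_const, Finset.card_univ, Fintype.card_fin, sampleMean,
    ← Nat.cast_smul_eq_nsmul ℝ, smul_inv_smul₀ this, sub_self]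

lemma sum_smul_sub_sampleMean {n d : ℕ} (A : Fin n → EuclideanSpace ℝ (Fin d)) (v : Fin n → ℝ) :
    ∑ i, v i • (A i - sampleMean A) = ∑ i, (v i - (∑ j, v j) / n) • A i := by
  simp only [smul_sub, sub_smul]
  rw [Finset.sum_sub_distrib, Finset.sum_sub_distrib, ← Finset.sum_smul, ← Finset.smul_sum,
    sampleMean, smul_smul, div_eq_mul_inv]

lemma OpBound.abs_inner_sampleMean_le {n d : ℕ} (hn : 0 < n)
    {A : Fin n → EuclideanSpace ℝ (Fin d)} (hA : OpBound A) (a : EuclideanSpace ℝ (Fin d)) :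
    |⟪a, sampleMean A⟫_ℝ| ≤ 8 * ‖a‖ := by
  have hn' : (0 : ℝ) < n := by exact_mod_cast hn
  rw [sampleMean, real_inner_smul_right, inner_sum, abs_mul, abs_of_pos (inv_pos.2 hn'),
    inv_mul_le_iff₀ hn']
  refine (Finset.abs_sum_le_sum_abs _ _).trans ((hA.sum_abs_inner_le a).trans ?_)
  linarith

lemma OpBound.sum_inner_sub_sampleMean_sq_le {n d : ℕ} (hn : 0 < n)
    {A : Fin n → EuclideanSpace ℝ (Fin d)} (hA : OpBound A) (a : EuclideanSpace ℝ (Fin d)) :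
    ∑ i, ⟪A i - sampleMean A, a⟫_ℝ ^ 2 ≤ 64 * n * ‖a‖ ^ 2 := by
  refine le_trans ?_ (hA a)
  have h1 : ∑ i, ⟪A i - sampleMean A, a⟫_ℝ = 0 := by
    rw [← sum_inner, sum_sub_sampleMean hn, inner_zero_left]
  have h2 : ∀ i, ⟪a, A i⟫_ℝ ^ 2 = ⟪A i - sampleMean A, a⟫_ℝ ^ 2 +
      2 * ⟪a, sampleMean A⟫_ℝ * ⟪A i - sampleMean A, a⟫_ℝ + ⟪a, sampleMean A⟫_ℝ ^ 2 := by
    intro i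
    rw [real_inner_comm a (A i - _), inner_sub_right]; ring
  simp only [h2]
  rw [Finset.sum_add_distrib, Finset.sum_add_distrib, ← Finset.mul_sum, h1, mul_zero, add_zero]
  have : 0 ≤ ∑ i : Fin n, ⟪a, sampleMean A⟫_ℝ ^ 2 := by positivity
  linarith

lemma OpBound.sum_abs_inner_sub_sampleMean_le {n d : ℕ} (hn : 0 < n)
    {A : Fin n → EuclideanSpace ℝ (Fin d)} (hA : OpBound A) (a : EuclideanSpace ℝ (Fin d)) :
    ∑ i, |⟪A i - sampleMean A, a⟫_ℝ| ≤ 8 * n * ‖a‖ := by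
  refine abs_le_of_sq_le_sq' ?_ (by positivity) |>.2
  have h1 := sq_sum_le_card_mul_sum_sq (s := Finset.univ)
    (f := fun i => |⟪A i - sampleMean A, a⟫_ℝ|)
  simp only [sq_abs, Finset.card_univ, Fintype.card_fin] at h1
  have h2 := mul_le_mul_of_nonneg_left (hA.sum_inner_sub_sampleMean_sq_le hn a)
    (Nat.cast_nonneg (α := ℝ) n)
  nlinarith

lemma SpreadBound.norm_le {n d : ℕ} (hn : 0 < n) {r : ℝ} (hr : 0 < r)
    {A : Fin n → EuclideanSpace ℝ (Fin d)} (hA : SpreadBound r A) {a : EuclideanSpace ℝ (Fin d)}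
    (ha : ∀ i, ⟪A i - sampleMean A, a⟫_ℝ ≤ 1) : ‖a‖ ≤ 2 / r := by
  have hn' : (0 : ℝ) < n := by exact_mod_cast hn
  have h1 : ∑ i, ⟪A i - sampleMean A, a⟫_ℝ = 0 := by
    rw [← sum_inner, sum_sub_sampleMean hn, inner_zero_left]
  have h2 := hA a ⟪a, sampleMean A⟫_ℝ
  have h3 : ∑ i, |⟪a, A i⟫_ℝ - ⟪a, sampleMean A⟫_ℝ| ≤
      ∑ i, (2 - ⟪A i - sampleMean A, a⟫_ℝ) := by
    refine Finset.sum_le_sum fun i _ => ?_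
    have := ha i
    rw [← inner_sub_right, real_inner_comm, abs_le]
    constructor <;> linarith
  rw [Finset.sum_sub_distrib, h1, sub_zero, Finset.sum_const, Finset.card_univ, Fintype.card_fin,
    nsmul_eq_mul] at h3
  rw [le_div_iff₀ hr]
  refine le_of_mul_le_mul_left (a := (n : ℝ)) ?_ hn'
  linarith

lemma AvoidBound.exists_inner_le {n d : ℕ} (hn : 0 < n) {c : ℝ} (hc : 0 < c)
    {S : Finset (Fin n)} {A : Fin n → EuclideanSpace ℝ (Fin d)} (hA : AvoidBound c S A)
    (b : Fin n → Bool) :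
    ∃ a, (∀ i, ⟪A i - sampleMean A, a⟫_ℝ ≤ 1) ∧
      c * n ≤ ⟪∑ i, signVec S b i • (A i - sampleMean A), a⟫_ℝ := by
  have hn' : (0 : ℝ) < n := by exact_mod_cast hn
  set B : Fin n → EuclideanSpace ℝ (Fin d) := fun i => A i - sampleMean A
  set θ := ∑ i, signVec S b i • B i with hθ
  have hcn : 0 < c * n := by positivity
  have hB0 : ∑ i, B i = 0 := sum_sub_sampleMean hn A
  have hmem : (c * n)⁻¹ • θ ∉ convexHull ℝ (Set.range B) := by
    intro hmem
    obtain ⟨w, hw0, hw1, hw⟩ := exists_weights_of_mem_convexHull_range hmem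
    refine hA b (fun i => c * n * w i) (fun i => mul_nonneg hcn.le (hw0 i))
      (by rw [← Finset.mul_sum, hw1, mul_one]) ?_
    have h1 : ∑ i, (c * n * w i - signVec S b i) • B i = 0 := by
      simp only [sub_smul, mul_smul (c * n)]
      rw [Finset.sum_sub_distrib, ← Finset.smul_sum, hw, smul_inv_smul₀ hcn.ne', sub_self]
    rw [← h1]
    simp only [B]
    rw [sum_smul_sub_sampleMean]
    refine Finset.sum_congr rfl fun i _ => ?_
    rw [Finset.sum_sub_distrib, ← Finset.mul_sum, hw1]
    congr 2
    field_simp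
  obtain ⟨f, s, hf1, hf2⟩ := geometric_hahn_banach_closed_point (convex_convexHull ℝ _)
    ((Set.finite_range B).isClosed_convexHull ℝ) hmem
  have hfB : ∀ i, f (B i) < s := fun i => hf1 _ (subset_convexHull _ _ ⟨i, rfl⟩)
  have hs : 0 < s := by
    have h1 : ∑ i, f (B i) < ∑ i : Fin n, s :=
      Finset.sum_lt_sum_of_nonempty ⟨⟨0, hn⟩, Finset.mem_univ _⟩ fun i _ => hfB i
    rw [← map_sum, hB0, map_zero, Finset.sum_const, Finset.card_univ, Fintype.card_fin,
      nsmul_eq_mul] at h1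
    exact pos_of_mul_pos_right h1 hn'.le
  set a := s⁻¹ • (InnerProductSpace.toDual ℝ _).symm f
  have ha : ∀ y, ⟪y, a⟫_ℝ = s⁻¹ * f y := fun y => by
    rw [real_inner_smul_right, real_inner_comm, InnerProductSpace.toDual_symm_apply]
  refine ⟨a, fun i => ?_, ?_⟩
  · rw [ha, inv_mul_le_iff₀ hs, mul_one]; exact (hfB i).le
  · rw [ha, le_inv_mul_iff₀ hs]
    rw [map_smul, smul_eq_mul, lt_inv_mul_iff₀ hcn] at hf2
    linarith

lemma IsGood.exists_facet {n d : ℕ} (hn : 0 < n) {r c : ℝ} (hr : 0 < r) (hc : 0 < c)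
    {S : Finset (Fin n)} {A : Fin n → EuclideanSpace ℝ (Fin d)} (hA : IsGood r c S A)
    (b : Fin n → Bool) :
    ∃ (u : EuclideanSpace ℝ (Fin d)) (h : ℝ), ‖u‖ = 1 ∧ |h| ≤ 8 / c + 8 ∧
      c * r / 2 * n ≤ ∑ i, signVec S b i * ⟪A i - sampleMean A, u⟫_ℝ ∧
      ∀ ε x, x ∉ convexHull ℝ (Set.range A) → h - ε ≤ ⟪u, x⟫_ℝ → ⟪u, x⟫_ℝ < h →
        vf (convexHull ℝ (insert x (Set.range A))) ≤ ε := by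
  have hn' : (0 : ℝ) < n := by exact_mod_cast hn
  set m := sampleMean A
  set Q := {a : EuclideanSpace ℝ (Fin d) | ∀ i, ⟪A i - m, a⟫_ℝ ≤ 1}
  have hQ : IsCompact Q := by
    refine Metric.isCompact_of_isClosed_isBounded ?_ ?_
    · simp only [Q, Set.ofPred_forall]
      exact isClosed_iInter fun i => isClosed_le (by fun_prop) (by fun_prop)
    · refine isBounded_iff_forall_norm_le.2 ⟨2 / r, fun a ha => hA.spread.norm_le hn hr ha⟩
  obtain ⟨a₀, ha₀, hθ₀⟩ := hA.avoid.exists_inner_le hn hc b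
  obtain ⟨a, ha, hθ⟩ := hQ.exists_extremePoint_le_inner ha₀
    (∑ i, signVec S b i • (A i - m))
  have hspan := span_active_eq_top_of_mem_extremePoints ha
  have haQ : ∀ i, ⟪A i - m, a⟫_ℝ ≤ 1 := ha.1
  have hcn := hθ₀.trans hθ
  simp only [sum_inner, real_inner_smul_left] at hcn
  have hup : ‖a‖ ≤ 2 / r := hA.spread.norm_le hn hr haQ
  have hlow : c / 8 ≤ ‖a‖ := by
    have h1 : ∑ i, signVec S b i * ⟪A i - m, a⟫_ℝ ≤ ∑ i, |⟪A i - m, a⟫_ℝ| := by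
      refine Finset.sum_le_sum fun i _ => (le_abs_self _).trans ?_
      rw [abs_mul]
      exact mul_le_of_le_one_left (abs_nonneg _) (abs_signVec_le S b i)
    have h2 := hA.opBound.sum_abs_inner_sub_sampleMean_le hn a
    rw [div_le_iff₀ (by norm_num)]
    refine le_of_mul_le_mul_right (a := (n : ℝ)) ?_ hn'
    linarith
  have hapos : 0 < ‖a‖ := lt_of_lt_of_le (by positivity) hlow
  have ha0 : a ≠ 0 := norm_pos_iff.1 hapos
  have hu : ‖‖a‖⁻¹ • a‖ = 1 := by simp [norm_smul, hapos.ne']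
  refine ⟨‖a‖⁻¹ • a, ‖a‖⁻¹ + ⟪‖a‖⁻¹ • a, m⟫_ℝ, hu, ?_, ?_, fun ε x hx hx1 hx2 => ?_⟩
  · refine (abs_add_le _ _).trans (add_le_add ?_ ?_)
    · rw [abs_of_pos (inv_pos.2 hapos), inv_le_comm₀ hapos (by positivity), inv_div]
      exact hlow
    · have := hA.opBound.abs_inner_sampleMean_le hn (‖a‖⁻¹ • a)
      rwa [hu, mul_one] at this
  · have h1 : ∑ i, signVec S b i * ⟪A i - m, ‖a‖⁻¹ • a⟫_ℝ =
        ‖a‖⁻¹ * ∑ i, signVec S b i * ⟪A i - m, a⟫_ℝ := by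
      rw [Finset.mul_sum]
      refine Finset.sum_congr rfl fun i _ => ?_
      rw [real_inner_smul_right]; ring
    rw [h1, le_inv_mul_iff₀ hapos]
    refine le_trans ?_ hcn
    rw [le_div_iff₀ hr] at hup
    have : 0 < c * n := by positivity
    nlinarith
  · have h1 : ⟪x - m, a⟫_ℝ = ‖a‖ * (⟪‖a‖⁻¹ • a, x⟫_ℝ - ⟪‖a‖⁻¹ • a, m⟫_ℝ) := by
      rw [← inner_sub_right, real_inner_smul_left, mul_inv_cancel_left₀ hapos.ne',
        real_inner_comm]
    refine vf_le_of_span_active haQ hspan ha0 hx ?_ ?_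
    · rw [h1]
      have h2 : ⟪‖a‖⁻¹ • a, x⟫_ℝ - ⟪‖a‖⁻¹ • a, m⟫_ℝ < ‖a‖⁻¹ := by linarith
      have := mul_lt_mul_of_pos_left h2 hapos
      rwa [mul_inv_cancel₀ hapos.ne'] at this
    · rw [h1]
      have h2 : ‖a‖⁻¹ - ε ≤ ⟪‖a‖⁻¹ • a, x⟫_ℝ - ⟪‖a‖⁻¹ • a, m⟫_ℝ := by linarith
      have := mul_le_mul_of_nonneg_left h2 hapos.le
      rw [mul_sub, mul_inv_cancel₀ hapos.ne'] at this
      linarith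

/-- Second moment inequality for a finite union of events. -/
lemma sq_sum_measureReal_le {Ω ι : Type*} [MeasurableSpace Ω] [Fintype ι] (μ : Measure Ω)
    [IsFiniteMeasure μ] {E : ι → Set Ω} (hE : ∀ b, MeasurableSet (E b)) :
    (∑ b, μ.real (E b)) ^ 2 ≤ μ.real (⋃ b, E b) * ∑ b, ∑ b', μ.real (E b ∩ E b') := by
  set U := ⋃ b, E b
  have hU : MeasurableSet U := MeasurableSet.iUnion hE
  set χ : Set Ω → Ω → ℝ := fun s => s.indicator 1
  have hχ : ∀ s, MeasurableSet s → Integrable (χ s) μ := fun s hs =>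
    (integrable_const (1 : ℝ)).indicator hs
  have hfi : ∀ s, MeasurableSet s → ∫ x, χ s x ∂μ = μ.real s :=
    fun s hs => integral_indicator_one hs
  have hquad : ∀ t : ℝ, 0 ≤ μ.real U * (t * t) + (-2 * ∑ b, μ.real (E b)) * t +
      ∑ b, ∑ b', μ.real (E b ∩ E b') := by
    intro t
    have hpt : ∀ x, (∑ b, χ (E b) x - t * χ U x) ^ 2 =
        ∑ b, ∑ b', χ (E b ∩ E b') x - 2 * t * ∑ b, χ (E b) x + t ^ 2 * χ U x := by
      intro x
      have h1 : (∑ b, χ (E b) x) ^ 2 = ∑ b, ∑ b', χ (E b ∩ E b') x := by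
        rw [sq, Finset.sum_mul_sum]
        refine Finset.sum_congr rfl fun b _ => Finset.sum_congr rfl fun b' _ => ?_
        simp only [χ, Set.inter_indicator_one, Pi.mul_apply]
      have h2 : (∑ b, χ (E b) x) * χ U x = ∑ b, χ (E b) x := by
        rw [Finset.sum_mul]
        refine Finset.sum_congr rfl fun b _ => ?_
        have : E b ∩ U = E b := Set.inter_eq_left.2 (Set.subset_iUnion E b)
        conv_rhs => rw [← this]
        simp only [χ, Set.inter_indicator_one, Pi.mul_apply]
      have h3 : χ U x * χ U x = χ U x := by
        have : U ∩ U = U := Set.inter_self U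
        conv_rhs => rw [← this]
        simp only [χ, Set.inter_indicator_one, Pi.mul_apply]
      rw [← h1]
      calc (∑ b, χ (E b) x - t * χ U x) ^ 2
          = (∑ b, χ (E b) x) ^ 2 - 2 * t * ((∑ b, χ (E b) x) * χ U x) +
            t ^ 2 * (χ U x * χ U x) := by ring
        _ = _ := by rw [h2, h3]
    have hnn : 0 ≤ ∫ x, (∑ b, χ (E b) x - t * χ U x) ^ 2 ∂μ :=
      integral_nonneg fun x => sq_nonneg _
    have i1 : Integrable (fun x => ∑ b, ∑ b', χ (E b ∩ E b') x) μ :=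
      integrable_finsetSum _ fun b _ => integrable_finsetSum _ fun b' _ =>
        hχ _ ((hE b).inter (hE b'))
    have i2 : Integrable (fun x => ∑ b, χ (E b) x) μ :=
      integrable_finsetSum _ fun b _ => hχ _ (hE b)
    have i3 : Integrable (fun x => ∑ b, ∑ b', χ (E b ∩ E b') x - 2 * t * ∑ b, χ (E b) x) μ :=
      i1.sub (i2.const_mul _)
    simp only [hpt] at hnn
    rw [integral_add i3 ((hχ U hU).const_mul _),
      integral_sub i1 (i2.const_mul _), integral_const_mul, integral_const_mul,
      integral_finsetSum _ (fun b _ => integrable_finsetSum _ fun b' _ =>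
        hχ _ ((hE b).inter (hE b'))), integral_finsetSum _ (fun b _ => hχ _ (hE b)),
      hfi U hU] at hnn
    simp only [hfi _ (hE _)] at hnn
    have h4 : ∀ b, ∫ x, ∑ b', χ (E b ∩ E b') x ∂μ = ∑ b', μ.real (E b ∩ E b') := fun b => by
      rw [integral_finsetSum _ fun b' _ => hχ _ ((hE b).inter (hE b'))]
      exact Finset.sum_congr rfl fun b' _ => hfi _ ((hE b).inter (hE b'))
    simp only [h4] at hnn
    linarith
  have := discrim_le_zero hquad
  rw [discrim] at this
  linarith

/-- Hoeffding's inequality for random signs, as a counting statement. -/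
lemma card_filter_le_sum_signVec {n : ℕ} (S : Finset (Fin n)) (v : Fin n → ℝ) {V T : ℝ}
    (hV : 0 < V) (hv : ∑ i, v i ^ 2 ≤ V) (hT : 0 ≤ T) :
    ((Finset.univ.filter fun b : Fin n → Bool => T ≤ ∑ i, signVec S b i * v i).card : ℝ) ≤
      2 ^ n * Real.exp (-(T ^ 2 / (2 * V))) := by
  set s := T / V
  have hs : 0 ≤ s := by positivity
  set g : Fin n → Bool → ℝ := fun i β =>
    Real.exp (s * ((if i ∈ S then (if β then 1 else -1) else 0) * v i))
  have h1 : ∑ b : Fin n → Bool, Real.exp (s * ∑ i, signVec S b i * v i) =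
      ∏ i, ∑ β : Bool, g i β := by
    rw [Finset.prod_univ_sum, Fintype.piFinset_univ]
    refine Finset.sum_congr rfl fun b _ => ?_
    rw [Finset.mul_sum, Real.exp_sum]
    rfl
  have h2 : ∏ i, ∑ β : Bool, g i β ≤ 2 ^ n * Real.exp (s ^ 2 * V / 2) := by
    calc ∏ i, ∑ β : Bool, g i β ≤ ∏ i, (2 * Real.exp ((s * v i) ^ 2 / 2)) := by
          refine Finset.prod_le_prod
            (fun i _ => Finset.sum_nonneg fun _ _ => (Real.exp_pos _).le) fun i _ => ?_
          rw [Fintype.sum_bool]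
          by_cases hi : i ∈ S
          · have h3 := Real.cosh_le_exp_half_sq (s * v i)
            rw [Real.cosh_eq] at h3
            simp only [g, hi, if_true, one_mul, Bool.false_eq_true, if_false]
            have h4 : s * (-1 * v i) = -(s * v i) := by ring
            rw [h4]; linarith
          · simp only [g, hi, if_false, zero_mul, mul_zero, Real.exp_zero]
            have := Real.one_le_exp (x := (s * v i) ^ 2 / 2) (by positivity)
            linarith
      _ = 2 ^ n * Real.exp (∑ i, (s * v i) ^ 2 / 2) := by
          rw [Finset.prod_mul_distrib, Finset.prod_const, Finset.card_univ, Fintype.card_fin,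
            Real.exp_sum]
      _ ≤ 2 ^ n * Real.exp (s ^ 2 * V / 2) := by
          gcongr
          have h5 : ∑ i, (s * v i) ^ 2 / 2 = s ^ 2 * (∑ i, v i ^ 2) / 2 := by
            rw [Finset.mul_sum, Finset.sum_div]
            exact Finset.sum_congr rfl fun i _ => by ring
          rw [h5]; gcongr
  have h3 : ((Finset.univ.filter fun b : Fin n → Bool =>
      T ≤ ∑ i, signVec S b i * v i).card : ℝ) * Real.exp (s * T) ≤
      ∑ b : Fin n → Bool, Real.exp (s * ∑ i, signVec S b i * v i) := by
    rw [← nsmul_eq_mul, ← Finset.sum_const]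
    refine (Finset.sum_le_sum fun b hb => ?_).trans
      (Finset.sum_le_sum_of_subset_of_nonneg (Finset.filter_subset _ _)
        fun b _ _ => (Real.exp_pos _).le)
    exact Real.exp_le_exp.2 (mul_le_mul_of_nonneg_left (Finset.mem_filter.1 hb).2 hs)
  have h4 := (h3.trans h1.le).trans h2
  rw [← le_div_iff₀ (Real.exp_pos _), mul_div_assoc, ← Real.exp_sub] at h4
  refine h4.trans (le_of_eq ?_)
  congr 2
  simp only [s]; field_simp; ring

/-- The set of points at signed distance at most `ε` below the hyperplane `⟪u, x⟫ = h`. -/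
def slab {d : ℕ} (u : EuclideanSpace ℝ (Fin d)) (h ε : ℝ) : Set (EuclideanSpace ℝ (Fin d)) :=
  {x | ⟪u, x⟫_ℝ ∈ Set.Ico (h - ε) h}

lemma measurableSet_slab {d : ℕ} (u : EuclideanSpace ℝ (Fin d)) (h ε : ℝ) :
    MeasurableSet (slab u h ε) := by
  have : Measurable fun x : EuclideanSpace ℝ (Fin d) => ⟪u, x⟫_ℝ := by fun_prop
  exact this measurableSet_Ico

lemma stdGaussian_real_slab {d : ℕ} {u : EuclideanSpace ℝ (Fin d)} (hu : ‖u‖ = 1) (h ε : ℝ) :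
    (_root_.stdGaussian d).real (slab u h ε) = (gaussianReal 0 1).real (Set.Ico (h - ε) h) := by
  have h1 := map_inner_stdGaussian u
  have hu' : ‖u‖₊ = 1 := by ext; simpa using hu
  rw [hu', one_pow] at h1
  rw [← h1, map_measureReal_apply (by fun_prop) measurableSet_Ico]
  rfl

lemma stdGaussian_real_slab_inter_le {d : ℕ} {u u' : EuclideanSpace ℝ (Fin d)} (hu : ‖u‖ = 1)
    (hu' : ‖u'‖ = 1) {η : ℝ} (hη : 0 < η) (hρ : |⟪u, u'⟫_ℝ| ≤ 1 - η) (h h' : ℝ) {ε : ℝ}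
    (hε : 0 ≤ ε) :
    (_root_.stdGaussian d).real (slab u h ε ∩ slab u' h' ε) ≤ ε ^ 2 * (√η)⁻¹ := by
  set ρ := ⟪u, u'⟫_ℝ with hρdef
  have hρ2 : η ≤ 1 - ρ ^ 2 := by
    rw [← sq_abs]
    nlinarith [abs_nonneg ρ]
  set τ := √(1 - ρ ^ 2)
  have hτ0 : 0 < τ := Real.sqrt_pos.2 (by linarith)
  have hτ2 : τ ^ 2 = 1 - ρ ^ 2 := Real.sq_sqrt (by linarith)
  set e := τ⁻¹ • (u' - ρ • u)
  have hue : ⟪u, e⟫_ℝ = 0 := by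
    rw [real_inner_smul_right, inner_sub_right, real_inner_smul_right, real_inner_self_eq_norm_sq,
      hu, ← hρdef]; ring
  have he : ‖e‖ = 1 := by
    have h1 : ‖u' - ρ • u‖ ^ 2 = τ ^ 2 := by
      rw [norm_sub_sq_real, norm_smul, mul_pow, Real.norm_eq_abs, sq_abs, hu, hu',
        real_inner_smul_right, real_inner_comm, ← hρdef, hτ2]; ring
    rw [norm_smul, norm_inv, Real.norm_of_nonneg hτ0.le,
      (pow_left_inj₀ (norm_nonneg _) hτ0.le two_ne_zero).1 h1, inv_mul_cancel₀ hτ0.ne']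
  have hdec : ∀ x, ⟪u', x⟫_ℝ = ρ * ⟪u, x⟫_ℝ + τ * ⟪e, x⟫_ℝ := fun x => by
    rw [real_inner_smul_left, inner_sub_left, real_inner_smul_left, mul_inv_cancel_left₀ hτ0.ne']
    ring
  set W : Set (ℝ × ℝ) := {p | p.1 ∈ Set.Ico (h - ε) h ∧ ρ * p.1 + τ * p.2 ∈ Set.Ico (h' - ε) h'}
  have hW : MeasurableSet W := by
    refine MeasurableSet.inter (measurable_fst measurableSet_Ico) ?_
    have : Measurable fun p : ℝ × ℝ => ρ * p.1 + τ * p.2 := by fun_prop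
    exact this measurableSet_Ico
  have heq : slab u h ε ∩ slab u' h' ε = (fun x => (⟪u, x⟫_ℝ, ⟪e, x⟫_ℝ)) ⁻¹' W := by
    ext x
    simp only [slab, W, Set.mem_inter_iff, Set.mem_ofPred_eq, Set.mem_preimage, hdec]
  rw [heq, ← map_measureReal_apply (by fun_prop) hW, map_inner_prod_stdGaussian hu he hue]
  have hsec : ∀ s, gaussianReal 0 1 (Prod.mk s ⁻¹' W) ≤
      (Set.Ico (h - ε) h).indicator (fun _ => ENNReal.ofReal (ε / τ)) s := by
    intro s
    by_cases hs : s ∈ Set.Ico (h - ε) h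
    · rw [Set.indicator_of_mem hs]
      have hsub : Prod.mk s ⁻¹' W ⊆ Set.Ico ((h' - ε - ρ * s) / τ) ((h' - ρ * s) / τ) := by
        rintro t ⟨-, ht1, ht2⟩
        simp only at ht1 ht2
        constructor
        · rw [div_le_iff₀ hτ0]; linarith
        · rw [lt_div_iff₀ hτ0]; linarith
      refine (measure_mono hsub).trans ?_
      rw [← ofReal_measureReal (measure_ne_top _ _)]
      refine ENNReal.ofReal_le_ofReal
        ((gaussianReal_real_Ico_le _ _ ?_).trans (le_of_eq (by ring)))
      gcongr; linarith
    · rw [Set.indicator_of_notMem hs]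
      have : Prod.mk s ⁻¹' W = ∅ := by
        ext t; simp only [W, Set.mem_preimage, Set.mem_ofPred_eq, Set.mem_empty_iff_false]
        tauto
      rw [this, measure_empty]
  have hle : ((gaussianReal 0 1).prod (gaussianReal 0 1)) W ≤
      ENNReal.ofReal (ε / τ) * gaussianReal 0 1 (Set.Ico (h - ε) h) := by
    rw [Measure.prod_apply hW]
    refine (lintegral_mono hsec).trans ?_
    rw [lintegral_indicator measurableSet_Ico, lintegral_const, Measure.restrict_apply_univ]
  have hle' := ENNReal.toReal_mono (by finiteness) hle
  rw [ENNReal.toReal_mul, ENNReal.toReal_ofReal (by positivity)] at hle'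
  refine hle'.trans ?_
  have h1 : (gaussianReal 0 1 (Set.Ico (h - ε) h)).toReal ≤ ε :=
    (gaussianReal_real_Ico_le (h - ε) h (by linarith)).trans (le_of_eq (by ring))
  have h2 : τ⁻¹ ≤ (√η)⁻¹ := by
    have := Real.sqrt_pos.2 hη
    gcongr
    exact Real.sqrt_le_sqrt hρ2
  calc ε / τ * (gaussianReal 0 1 (Set.Ico (h - ε) h)).toReal ≤ ε / τ * ε := by gcongr
    _ = ε ^ 2 * τ⁻¹ := by ring
    _ ≤ _ := by gcongr

/-- Few sign vectors give rise to normals that are nearly parallel to a given one. -/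
lemma OpBound.card_filter_abs_inner_le {n d : ℕ} (hn : 0 < n) {g η : ℝ} (hg : 0 < g)
    (hη : η = g ^ 2 / 512) {S : Finset (Fin n)} {A : Fin n → EuclideanSpace ℝ (Fin d)}
    (hA : OpBound A) {u : (Fin n → Bool) → EuclideanSpace ℝ (Fin d)} (hu : ∀ b, ‖u b‖ = 1)
    (hug : ∀ b, g * n ≤ ∑ i, signVec S b i * ⟪A i - sampleMean A, u b⟫_ℝ)
    (b : Fin n → Bool) :
    ((Finset.univ.filter fun b' => 1 - η < |⟪u b, u b'⟫_ℝ|).card : ℝ) ≤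
      2 * 2 ^ n * Real.exp (-(η * n)) := by
  have hn' : (0 : ℝ) < n := by exact_mod_cast hn
  have key : ∀ w : EuclideanSpace ℝ (Fin d), ‖w‖ = 1 →
      ((Finset.univ.filter fun b' => 1 - η < ⟪w, u b'⟫_ℝ).card : ℝ) ≤
        2 ^ n * Real.exp (-(η * n)) := by
    intro w hw
    have h1 := card_filter_le_sum_signVec S (fun i => ⟪A i - sampleMean A, w⟫_ℝ)
      (V := 64 * n) (T := g * n / 2) (by positivity)
      (by simpa [hw] using hA.sum_inner_sub_sampleMean_sq_le hn w) (by positivity)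
    have h2 : (g * n / 2) ^ 2 / (2 * (64 * n)) = η * n := by
      rw [hη]; field_simp; norm_num
    rw [h2] at h1
    refine le_trans ?_ h1
    have hsub : (Finset.univ.filter fun b' => 1 - η < ⟪w, u b'⟫_ℝ) ⊆
        Finset.univ.filter fun b' : Fin n → Bool =>
          g * n / 2 ≤ ∑ i, signVec S b' i * ⟪A i - sampleMean A, w⟫_ℝ := by
      intro b' hb'
      rw [Finset.mem_filter] at hb' ⊢
      refine ⟨Finset.mem_univ _, ?_⟩
      have h3 : ‖u b' - w‖ ≤ g / 16 := by
        rw [← sq_le_sq₀ (norm_nonneg _) (by positivity), norm_sub_sq_real, hw, hu b',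
          real_inner_comm]
        have := hb'.2
        rw [hη] at this
        nlinarith
      have h4 := hA.sum_abs_inner_sub_sampleMean_le hn (u b' - w)
      have h5 : 8 * n * ‖u b' - w‖ ≤ 8 * n * (g / 16) := by gcongr
      have h6 : ∑ i, signVec S b' i * ⟪A i - sampleMean A, u b'⟫_ℝ ≤
          ∑ i, (signVec S b' i * ⟪A i - sampleMean A, w⟫_ℝ +
            |⟪A i - sampleMean A, u b' - w⟫_ℝ|) := by
        refine Finset.sum_le_sum fun i _ => ?_
        have h7 : signVec S b' i * ⟪A i - sampleMean A, u b'⟫_ℝ =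
            signVec S b' i * ⟪A i - sampleMean A, w⟫_ℝ +
              signVec S b' i * ⟪A i - sampleMean A, u b' - w⟫_ℝ := by
          rw [inner_sub_right]; ring
        rw [h7]
        gcongr
        refine (le_abs_self _).trans ?_
        rw [abs_mul]
        exact mul_le_of_le_one_left (abs_nonneg _) (abs_signVec_le S b' i)
      rw [Finset.sum_add_distrib] at h6
      have := hug b'
      linarith
    exact_mod_cast Finset.card_le_card hsub
  have h1 := key (u b) (hu b)
  have h2 := key (-u b) (by rw [norm_neg, hu b])
  have hsub : (Finset.univ.filter fun b' => 1 - η < |⟪u b, u b'⟫_ℝ|) ⊆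
      (Finset.univ.filter fun b' => 1 - η < ⟪u b, u b'⟫_ℝ) ∪
        Finset.univ.filter fun b' => 1 - η < ⟪-u b, u b'⟫_ℝ := by
    intro b' hb'
    simp only [Finset.mem_union, Finset.mem_filter, Finset.mem_univ, true_and, inner_neg_left]
      at hb' ⊢
    exact lt_abs.1 hb'
  have h3 : ((Finset.univ.filter fun b' => 1 - η < |⟪u b, u b'⟫_ℝ|).card : ℝ) ≤
      (Finset.univ.filter fun b' => 1 - η < ⟪u b, u b'⟫_ℝ).card +
        (Finset.univ.filter fun b' => 1 - η < ⟪-u b, u b'⟫_ℝ).card := by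
    exact_mod_cast (Finset.card_le_card hsub).trans (Finset.card_union_le _ _)
  linarith

lemma OpBound.stdGaussian_real_mem_convexHull_le {n d : ℕ} (hn : 0 < n)
    {A : Fin n → EuclideanSpace ℝ (Fin d)} (hA : OpBound A) :
    (_root_.stdGaussian d).real (convexHull ℝ (Set.range A)) ≤
      (7 / 8) ^ d + n * Real.exp (-(((d : ℝ) / 4) ^ 2 / (128 * n))) := by
  have hn' : (0 : ℝ) < n := by exact_mod_cast hn
  have hsub : convexHull ℝ (Set.range A) ⊆ {x | ‖x‖ ^ 2 ≤ (d : ℝ) / 4} ∪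
      ⋃ i ∈ (Finset.univ : Finset (Fin n)), {x | (d : ℝ) / 4 ≤ ⟪A i, x⟫_ℝ} := by
    intro x hx
    by_contra hcon
    simp only [Set.mem_union, Set.mem_iUnion, Set.mem_ofPred_eq, not_or, not_exists, not_le,
      Finset.mem_univ, forall_true_left] at hcon
    have hconv : Convex ℝ {y : EuclideanSpace ℝ (Fin d) | innerSL ℝ x y ≤ (d : ℝ) / 4} :=
      convex_halfSpace_le (innerSL ℝ x).toLinearMap.isLinear _
    have h1 : x ∈ {y : EuclideanSpace ℝ (Fin d) | innerSL ℝ x y ≤ (d : ℝ) / 4} := by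
      refine convexHull_min ?_ hconv hx
      rintro _ ⟨i, rfl⟩
      simp only [Set.mem_ofPred_eq, innerSL_apply_apply]
      rw [real_inner_comm]
      exact (hcon.2 i).le
    simp only [Set.mem_ofPred_eq, innerSL_apply_apply, real_inner_self_eq_norm_sq] at h1
    linarith
  refine (measureReal_mono hsub (measure_ne_top _ _)).trans ((measureReal_union_le _ _).trans
    (add_le_add ?_ ?_))
  · refine (stdGaussian_real_norm_sq_le d (s := 3 / 2) (by norm_num) _).trans ?_
    have h1 : √(1 + 2 * (3 / 2) : ℝ) = 2 := by
      rw [show (1 + 2 * (3 / 2) : ℝ) = 2 ^ 2 by norm_num, Real.sqrt_sq (by norm_num)]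
    have h2 : Real.exp (3 / 2 * (d / 4)) = Real.exp (3 / 8) ^ d := by
      rw [← Real.exp_nat_mul]; congr 1; ring
    rw [h1, h2, ← mul_pow]
    refine pow_le_pow_left₀ (by positivity) ?_ _
    have h3 : Real.exp (1 / 2) ^ 2 = Real.exp 1 := by rw [← Real.exp_nat_mul]; norm_num
    have h4 : Real.exp (3 / 8) ≤ Real.exp (1 / 2) := Real.exp_le_exp.2 (by norm_num)
    have := Real.exp_one_lt_d9
    nlinarith [Real.exp_pos (1 / 2)]
  · refine (measureReal_biUnion_finset_le _ _).trans ?_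
    refine (Finset.sum_le_sum fun i _ => stdGaussian_real_le_inner (A i) (R := √(64 * n))
      (by positivity) (Real.le_sqrt_of_sq_le (hA.norm_le i)) (by positivity)).trans ?_
    rw [Finset.sum_const, Finset.card_univ, Fintype.card_fin, nsmul_eq_mul,
      Real.sq_sqrt (by positivity), ← mul_assoc]
    norm_num

lemma OpBound.le_stdGaussian_real_iUnion_slab {n d : ℕ} (hn : 0 < n) {g η H : ℝ} (hg : 0 < g)
    (hη : η = g ^ 2 / 512) {S : Finset (Fin n)} {A : Fin n → EuclideanSpace ℝ (Fin d)}
    (hA : OpBound A) {u : (Fin n → Bool) → EuclideanSpace ℝ (Fin d)} (hu : ∀ b, ‖u b‖ = 1)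
    (hug : ∀ b, g * n ≤ ∑ i, signVec S b i * ⟪A i - sampleMean A, u b⟫_ℝ)
    {h : (Fin n → Bool) → ℝ} (hh : ∀ b, |h b| ≤ H) :
    gaussianPDFReal 0 1 (H + 1) ^ 2 / (2 + (√η)⁻¹) ≤
      (_root_.stdGaussian d).real (⋃ b, slab (u b) (h b) (Real.exp (-(η * n)))) := by
  have hη0 : 0 < η := by rw [hη]; positivity
  set ε := Real.exp (-(η * n))
  have hε : 0 < ε := Real.exp_pos _
  have hε1 : ε ≤ 1 := Real.exp_le_one_iff.2 (by have := hη0; simp; positivity)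
  set p := gaussianPDFReal 0 1 (H + 1)
  have hp : 0 ≤ p := gaussianPDFReal_nonneg _ _ _
  set E : (Fin n → Bool) → Set (EuclideanSpace ℝ (Fin d)) := fun b => slab (u b) (h b) ε
  have hE : ∀ b, MeasurableSet (E b) := fun b => measurableSet_slab _ _ _
  have hEle : ∀ b, (_root_.stdGaussian d).real (E b) ≤ ε := fun b => by
    rw [stdGaussian_real_slab (hu b)]
    exact (gaussianReal_real_Ico_le _ _ (by linarith)).trans (le_of_eq (by ring))
  have hleE : ∀ b, ε * p ≤ (_root_.stdGaussian d).real (E b) := fun b => by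
    rw [stdGaussian_real_slab (hu b)]
    exact le_gaussianReal_real_Ico (hh b) hε.le hε1
  have hcard : (Finset.univ : Finset (Fin n → Bool)).card = 2 ^ n := by simp
  have hpair : ∀ b, ∑ b', (_root_.stdGaussian d).real (E b ∩ E b') ≤
      2 ^ n * (ε ^ 2 * (2 + (√η)⁻¹)) := by
    intro b
    calc ∑ b', (_root_.stdGaussian d).real (E b ∩ E b')
        ≤ ∑ b', ((if 1 - η < |⟪u b, u b'⟫_ℝ| then ε else 0) + ε ^ 2 * (√η)⁻¹) := by
          refine Finset.sum_le_sum fun b' _ => ?_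
          split_ifs with hnear
          · have : (_root_.stdGaussian d).real (E b ∩ E b') ≤ ε :=
              (measureReal_mono Set.inter_subset_left).trans (hEle b)
            have : 0 ≤ ε ^ 2 * (√η)⁻¹ := by positivity
            linarith
          · rw [zero_add]
            exact stdGaussian_real_slab_inter_le (hu b) (hu b') hη0 (not_lt.1 hnear) _ _ hε.le
      _ = (Finset.univ.filter fun b' => 1 - η < |⟪u b, u b'⟫_ℝ|).card * ε +
            2 ^ n * (ε ^ 2 * (√η)⁻¹) := by
          rw [Finset.sum_add_distrib, ← Finset.sum_filter, Finset.sum_const, Finset.sum_const,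
            hcard, nsmul_eq_mul, nsmul_eq_mul]
          push_cast; rfl
      _ ≤ 2 * 2 ^ n * ε * ε + 2 ^ n * (ε ^ 2 * (√η)⁻¹) := by
          gcongr
          exact hA.card_filter_abs_inner_le hn hg hη hu hug b
      _ = 2 ^ n * (ε ^ 2 * (2 + (√η)⁻¹)) := by ring
  have h1 := sq_sum_measureReal_le (_root_.stdGaussian d) hE
  have h2 : ∑ b, ∑ b', (_root_.stdGaussian d).real (E b ∩ E b') ≤
      2 ^ n * (2 ^ n * (ε ^ 2 * (2 + (√η)⁻¹))) := by
    refine (Finset.sum_le_sum fun b _ => hpair b).trans (le_of_eq ?_)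
    rw [Finset.sum_const, hcard, nsmul_eq_mul]; push_cast; rfl
  have h3 : 2 ^ n * (ε * p) ≤ ∑ b, (_root_.stdGaussian d).real (E b) := by
    refine le_trans (le_of_eq ?_) (Finset.sum_le_sum fun b _ => hleE b)
    rw [Finset.sum_const, hcard, nsmul_eq_mul]; push_cast; rfl
  have h4 : (2 ^ n * (ε * p)) ^ 2 ≤ (∑ b, (_root_.stdGaussian d).real (E b)) ^ 2 :=
    pow_le_pow_left₀ (by positivity) h3 2
  have h5 := mul_le_mul_of_nonneg_left h2
    (measureReal_nonneg (μ := _root_.stdGaussian d) (s := ⋃ b, E b))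
  have h6 := (h4.trans h1).trans h5
  rw [div_le_iff₀ (by positivity)]
  refine le_of_mul_le_mul_left (a := ((2 : ℝ) ^ n * ε) ^ 2) ?_ (by positivity)
  calc ((2 : ℝ) ^ n * ε) ^ 2 * p ^ 2 = (2 ^ n * (ε * p)) ^ 2 := by ring
    _ ≤ _ := h6
    _ = _ := by ring

/-- Conditionally on a good configuration, one further Gaussian point makes the vertex-facet
distance exponentially small with probability bounded below. -/
lemma IsGood.le_stdGaussian_real_vf_le {n d : ℕ} (hn : 0 < n) {r c η : ℝ} (hr : 0 < r)
    (hc : 0 < c) (hη : η = (c * r / 2) ^ 2 / 512) {S : Finset (Fin n)}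
    {A : Fin n → EuclideanSpace ℝ (Fin d)} (hA : IsGood r c S A) :
    gaussianPDFReal 0 1 (8 / c + 8 + 1) ^ 2 / (2 + (√η)⁻¹) -
      ((7 / 8) ^ d + n * Real.exp (-(((d : ℝ) / 4) ^ 2 / (128 * n)))) ≤
      (_root_.stdGaussian d).real
        {x | vf (convexHull ℝ (insert x (Set.range A))) ≤ Real.exp (-(η * n))} := by
  choose u h hu hh hug hvf using fun b => hA.exists_facet hn hr hc b
  have h1 := OpBound.le_stdGaussian_real_iUnion_slab hn (by positivity : 0 < c * r / 2) hη
    hA.opBound hu hug hh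
  have h2 := hA.opBound.stdGaussian_real_mem_convexHull_le hn
  have hsub : (⋃ b, slab (u b) (h b) (Real.exp (-(η * n)))) ⊆
      {x | vf (convexHull ℝ (insert x (Set.range A))) ≤ Real.exp (-(η * n))} ∪
        convexHull ℝ (Set.range A) := by
    intro x hx
    obtain ⟨b, hb⟩ := Set.mem_iUnion.1 hx
    by_cases hxA : x ∈ convexHull ℝ (Set.range A)
    · exact Or.inr hxA
    · exact Or.inl (hvf b _ x hxA hb.1 hb.2)
  have h3 := (measureReal_mono hsub (measure_ne_top (_root_.stdGaussian d) _)).trans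
    (measureReal_union_le _ _)
  linarith

/-- A lower bound on the conditional probability of `T` given all points but the first one, valid
outside `B`, integrates to a lower bound on the probability of `T`; no measurability is needed. -/
lemma mul_one_sub_le_pi_of_forall_cons {α : Type*} [MeasurableSpace α] (γ : Measure α)
    [IsProbabilityMeasure γ] {n : ℕ} {B : Set (Fin n → α)} {T : Set (Fin (n + 1) → α)} {p : ℝ≥0∞}
    (h : ∀ A ∉ B, p ≤ γ {x | (Fin.cons x A : Fin (n + 1) → α) ∈ T}) :
    p * (1 - (Measure.pi fun _ : Fin n => γ) B) ≤ (Measure.pi fun _ : Fin (n + 1) => γ) T := by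
  set μ := Measure.pi fun _ : Fin n => γ
  have he := (measurePreserving_piFinSuccAbove (fun _ : Fin (n + 1) => γ) 0).symm
  rw [← measure_toMeasurable T,
    ← he.measure_preimage (measurableSet_toMeasurable _ _).nullMeasurableSet,
    Measure.prod_apply_symm (he.measurable (measurableSet_toMeasurable _ _))]
  rw [← measure_toMeasurable B, ← prob_compl_eq_one_sub (measurableSet_toMeasurable _ _),
    ← setLIntegral_const]
  refine (setLIntegral_mono' (measurableSet_toMeasurable μ B).compl fun A hA => ?_).trans
    (setLIntegral_le_lintegral _ _)
  refine (h A fun hB => hA (subset_toMeasurable _ _ hB)).trans (measure_mono fun x hx => ?_)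
  refine subset_toMeasurable _ _ ?_
  simpa [MeasurableEquiv.piFinSuccAbove, Fin.insertNthEquiv] using hx

lemma eventually_floor_bounds {δ : ℝ} (hδ : 0 < δ) :
    ∀ᶠ n : ℕ in Filter.atTop, 0 < ⌊δ * (n : ℝ)⌋₊ ∧ δ * n / 2 ≤ (⌊δ * (n : ℝ)⌋₊ : ℝ) := by
  have h : Filter.Tendsto (fun n : ℕ => δ * (n : ℝ)) Filter.atTop Filter.atTop :=
    tendsto_natCast_atTop_atTop.const_mul_atTop hδ
  filter_upwards [h.eventually_ge_atTop 2] with n hn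
  have h1 := Nat.sub_one_lt_floor (δ * (n : ℝ))
  refine ⟨Nat.floor_pos.2 (by linarith), by linarith⟩

lemma tendsto_pow_floor_add_mul_exp {δ : ℝ} (hδ : 0 < δ) :
    Filter.Tendsto (fun n : ℕ => (7 / 8 : ℝ) ^ ⌊δ * (n : ℝ)⌋₊ +
      n * Real.exp (-(((⌊δ * (n : ℝ)⌋₊ : ℝ) / 4) ^ 2 / (128 * n)))) Filter.atTop (nhds 0) := by
  have h : Filter.Tendsto (fun n : ℕ => δ * (n : ℝ)) Filter.atTop Filter.atTop :=
    tendsto_natCast_atTop_atTop.const_mul_atTop hδ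
  rw [← add_zero (0 : ℝ)]
  refine Filter.Tendsto.add ?_ ?_
  · exact (tendsto_pow_atTop_nhds_zero_of_lt_one (by norm_num) (by norm_num)).comp
      (tendsto_nat_floor_atTop.comp h)
  · have hε : 0 < δ ^ 2 / 8192 := by positivity
    have h2 : Filter.Tendsto (fun n : ℕ => (n : ℝ) * Real.exp (-(δ ^ 2 / 8192) * n))
        Filter.atTop (nhds 0) := by
      have := (Real.tendsto_pow_mul_exp_neg_atTop_nhds_zero 1).comp
        (tendsto_natCast_atTop_atTop.const_mul_atTop hε : Filter.Tendsto
          (fun n : ℕ => δ ^ 2 / 8192 * (n : ℝ)) Filter.atTop Filter.atTop)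
      have := this.const_mul (δ ^ 2 / 8192)⁻¹
      rw [mul_zero] at this
      refine this.congr fun n => ?_
      simp only [Function.comp, pow_one, neg_mul]
      field_simp
    refine squeeze_zero' (.of_forall fun n => by positivity) ?_ h2
    filter_upwards [eventually_floor_bounds hδ, Filter.eventually_gt_atTop 0] with n hn hn0
    have hn0' : (0 : ℝ) < n := by exact_mod_cast hn0
    gcongr
    rw [neg_mul, neg_le_neg_iff, le_div_iff₀ (by positivity)]
    have := pow_le_pow_left₀ (by positivity) hn.2 2
    nlinarith

/-- The vertex-facet distance of a Gaussian polytope is exponentially small in the dimension with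
probability bounded below. -/
lemma exists_eventually_le_pi_stdGaussian_vf_le {δ : ℝ} (hδ0 : 0 < δ) (hδ1 : δ < 1) :
    ∃ c c' : ℝ, 0 < c ∧ c < 1 ∧ 0 < c' ∧ c' < 1 ∧ ∀ᶠ n : ℕ in Filter.atTop,
      ENNReal.ofReal c' ≤ (Measure.pi fun _ : Fin (n + 1) => _root_.stdGaussian ⌊δ * (n : ℝ)⌋₊)
        {ω | vf (convexHull ℝ (Set.range ω)) ≤ c ^ ⌊δ * (n : ℝ)⌋₊} := by
  obtain ⟨r, c, hr, -, hc, -, hgood⟩ := exists_pi_stdGaussian_real_not_isGood_le hδ0 hδ1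
  obtain ⟨η, hη⟩ : ∃ η, η = (c * r / 2) ^ 2 / 512 := ⟨_, rfl⟩
  have hη0 : 0 < η := by rw [hη]; positivity
  obtain ⟨q, hq⟩ : ∃ q, q = gaussianPDFReal 0 1 (8 / c + 8 + 1) ^ 2 / (2 + (√η)⁻¹) := ⟨_, rfl⟩
  have hpdf := gaussianPDFReal_pos 0 1 (8 / c + 8 + 1) one_ne_zero
  have hq0 : 0 < q := by rw [hq]; positivity
  have hq1 : q < 1 := by
    have h1 : gaussianPDFReal 0 1 (8 / c + 8 + 1) ≤ 1 := by
      simpa using gaussianPDFReal_zero_le 1 (8 / c + 8 + 1)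
    have h2 : 0 < (√η)⁻¹ := by positivity
    rw [hq, div_lt_one (by positivity)]
    nlinarith
  refine ⟨Real.exp (-η), q / 4, Real.exp_pos _, by simpa using hη0, by positivity,
    by linarith, ?_⟩
  have hbad : Filter.Tendsto (fun n : ℕ => (2 + 19 / r) * (1 / 2 : ℝ) ^ n) Filter.atTop
      (nhds 0) := by
    simpa using (tendsto_pow_atTop_nhds_zero_of_lt_one (by norm_num : (0 : ℝ) ≤ 1 / 2)
      (by norm_num)).const_mul (2 + 19 / r)
  filter_upwards [eventually_floor_bounds hδ0, Filter.eventually_ge_atTop 2,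
    hbad.eventually_le_const (by norm_num : (0 : ℝ) < 1 / 2),
    (tendsto_pow_floor_add_mul_exp hδ0).eventually_le_const (half_pos hq0)]
    with n hn hn2 hnbad hnerr
  have hdn : (⌊δ * (n : ℝ)⌋₊ : ℝ) ≤ δ * n := Nat.floor_le (by positivity)
  generalize ⌊δ * (n : ℝ)⌋₊ = d at *
  obtain ⟨S, hS⟩ := exists_isBalanced hn2
  have hB := (hgood n d hn.1 hdn hn.2 S hS).trans hnbad
  have hdn' : (d : ℝ) ≤ n := hdn.trans (mul_le_of_le_one_left (by positivity) hδ1.le)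
  have key := mul_one_sub_le_pi_of_forall_cons (_root_.stdGaussian d)
    (B := {A : Fin n → EuclideanSpace ℝ (Fin d) | ¬ IsGood r c S A})
    (T := {ω | vf (convexHull ℝ (Set.range ω)) ≤ Real.exp (-η) ^ d})
    (p := ENNReal.ofReal (q / 2)) ?_
  · refine le_trans ?_ key
    rw [show q / 4 = q / 2 * (1 / 2) by ring, ENNReal.ofReal_mul (by positivity)]
    gcongr
    rw [← ofReal_measureReal, ← ENNReal.ofReal_one, ← ENNReal.ofReal_sub _ measureReal_nonneg]
    exact ENNReal.ofReal_le_ofReal (by linarith)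
  · intro A hA
    have hA' : IsGood r c S A := not_not.1 hA
    have h1 := hA'.le_stdGaussian_real_vf_le (by omega) hr hc hη
    rw [← hq] at h1
    rw [← ofReal_measureReal]
    refine ENNReal.ofReal_le_ofReal (le_trans (by linarith) (h1.trans ?_))
    refine measureReal_mono (fun x hx => ?_) (measure_ne_top _ _)
    simp only [Set.mem_ofPred_eq, Fin.range_cons] at hx ⊢
    refine hx.trans ?_
    rw [← Real.exp_nat_mul, Real.exp_le_exp]
    nlinarith

/-- Theorem: let `δ ∈ (0,1)`, let `A₁, …, A_{n+1}` be iid standard Gaussian points in `ℝ^d`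
with `d = ⌊δ n⌋`, and `P_{n+1}` their convex hull. Then
(i) `ℙ(diam P_{n+1} ≥ √d) ≥ 1 - e^{-nd/32}`, and
(ii) there are constants `0 < c, c' < 1` (depending only on `δ`) with
`liminf_{n → ∞} ℙ(vf P_{n+1} ≤ c^d) ≥ c'`. -/
theorem stmt2 (δ : ℝ) (hδ : δ ∈ Set.Ioo (0 : ℝ) 1) :
    (∀ n : ℕ,
      ENNReal.ofReal (1 - Real.exp (-((n : ℝ) * (⌊δ * (n : ℝ)⌋₊ : ℝ)) / 32)) ≤
        (Measure.pi fun _ : Fin (n + 1) => stdGaussian ⌊δ * (n : ℝ)⌋₊)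
          {ω : Fin (n + 1) → EuclideanSpace ℝ (Fin ⌊δ * (n : ℝ)⌋₊) |
            Real.sqrt (⌊δ * (n : ℝ)⌋₊ : ℝ) ≤ Metric.diam (convexHull ℝ (Set.range ω))}) ∧
    ∃ c c' : ℝ, 0 < c ∧ c < 1 ∧ 0 < c' ∧ c' < 1 ∧
      ENNReal.ofReal c' ≤
        Filter.liminf (fun n : ℕ =>
          (Measure.pi fun _ : Fin (n + 1) => stdGaussian ⌊δ * (n : ℝ)⌋₊)
            {ω : Fin (n + 1) → EuclideanSpace ℝ (Fin ⌊δ * (n : ℝ)⌋₊) |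
              vf (convexHull ℝ (Set.range ω)) ≤ c ^ ⌊δ * (n : ℝ)⌋₊}) Filter.atTop := by
  refine ⟨fun n => le_pi_stdGaussian_sqrt_le_diam n _, ?_⟩
  obtain ⟨c, c', hc0, hc1, hc0', hc1', h⟩ :=
    exists_eventually_le_pi_stdGaussian_vf_le hδ.1 hδ.2
  exact ⟨c, c', hc0, hc1, hc0', hc1', Filter.le_liminf_of_le (by isBoundedDefault) h⟩
end

section
/- Let A be the vertex set of a simplex in ℝ^d (i.e., a set of affinely independent points) and let A₀ ⊆ A be a subset containing at least two points. Then width(A) ≤ width(A₀). In particular, minwidth(A) = width(A). -/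
/-- The directional width of a finite set `A` with respect to a direction `r`. -/
noncomputable def dirW {d : ℕ} (A : Finset (EuclideanSpace ℝ (Fin d)))
    (r : EuclideanSpace ℝ (Fin d)) : ℝ :=
  sSup { p : ℝ | ∃ s ∈ A, ∃ v ∈ A, p = (inner ℝ (‖r‖⁻¹ • r) (s - v) : ℝ) }

/-- The width of a finite set `A`: the infimum of the directional widths over nonzero
directions in the linear subspace parallel to the affine hull of `A`. -/
noncomputable def width {d : ℕ} (A : Finset (EuclideanSpace ℝ (Fin d))) : ℝ :=
  sInf { w : ℝ | ∃ r : EuclideanSpace ℝ (Fin d), r ≠ 0 ∧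
    r ∈ (affineSpan ℝ (A : Set (EuclideanSpace ℝ (Fin d)))).direction ∧ w = dirW A r }

/-- The minwidth of a finite set `A`: the minimum width over all subsets of `A` with at
least two elements. -/
noncomputable def minwidth {d : ℕ} (A : Finset (EuclideanSpace ℝ (Fin d))) : ℝ :=
  sInf { w : ℝ | ∃ B : Finset (EuclideanSpace ℝ (Fin d)), B ⊆ A ∧ 2 ≤ B.card ∧ w = width B }

open scoped RealInnerProductSpace

/-- Differences of values on an affinely independent family can be realised as inner products
with a vector of its vector span. -/
theorem AffineIndependent.exists_inner_sub_eq {ι E : Type*} [NormedAddCommGroup E]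
    [InnerProductSpace ℝ E] [FiniteDimensional ℝ E] {p : ι → E} (hp : AffineIndependent ℝ p)
    (c : ι → ℝ) :
    ∃ r ∈ vectorSpan ℝ (Set.range p), ∀ i j, ⟪r, p i - p j⟫ = c i - c j := by
  rcases isEmpty_or_nonempty ι with h | ⟨⟨i₀⟩⟩
  · exact ⟨0, zero_mem _, fun i => h.elim i⟩
  have hli := (affineIndependent_iff_linearIndependent_vsub ℝ p i₀).1 hp
  obtain ⟨g, hg⟩ := LinearMap.exists_extend
    ((Finsupp.linearCombination ℝ fun x : {x // x ≠ i₀} => c x - c i₀) ∘ₗ hli.repr)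
  have hgi (i : ι) : g (p i - p i₀) = c i - c i₀ := by
    by_cases hi : i = i₀
    · simp [hi]
    have hmem := Submodule.subset_span (R := ℝ)
      (Set.mem_range_self (f := fun x : {x // x ≠ i₀} => p x -ᵥ p i₀) ⟨i, hi⟩)
    have h := LinearMap.congr_fun hg ⟨_, hmem⟩
    rw [LinearMap.comp_apply, LinearMap.comp_apply, hli.repr_eq_single ⟨i, hi⟩ ⟨_, hmem⟩ rfl,
      Finsupp.linearCombination_single, one_smul] at h
    exact h
  let V := vectorSpan ℝ (Set.range p)
  let v := (InnerProductSpace.toDual ℝ E).symm (LinearMap.toContinuousLinearMap g)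
  refine ⟨V.starProjection v, V.starProjection_apply_mem v, fun i j => ?_⟩
  have hV : p i - p j ∈ V :=
    vsub_mem_vectorSpan ℝ (Set.mem_range_self i) (Set.mem_range_self j)
  rw [Submodule.inner_starProjection_left_eq_right, Submodule.starProjection_eq_self_iff.2 hV,
    InnerProductSpace.toDual_symm_apply, LinearMap.coe_toContinuousLinearMap',
    ← sub_sub_sub_cancel_right (p i) (p j) (p i₀), map_sub, hgi, hgi]
  ring

section

variable {d : ℕ} {A A₀ : Finset (EuclideanSpace ℝ (Fin d))}

theorem inner_le_dirW (r : EuclideanSpace ℝ (Fin d)) {s v : EuclideanSpace ℝ (Fin d)}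
    (hs : s ∈ A) (hv : v ∈ A) : ‖r‖⁻¹ * ⟪r, s - v⟫ ≤ dirW A r := by
  refine le_csSup ?_ ⟨s, hs, v, hv, (real_inner_smul_left _ _ _).symm⟩
  refine (((A ×ˢ A).finite_toSet.image fun q => ⟪‖r‖⁻¹ • r, q.1 - q.2⟫).subset ?_).bddAbove
  rintro _ ⟨s, hs, v, hv, rfl⟩
  exact ⟨(s, v), by simp [hs, hv], rfl⟩

theorem dirW_nonneg (A : Finset (EuclideanSpace ℝ (Fin d))) (r : EuclideanSpace ℝ (Fin d)) :
    0 ≤ dirW A r := by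
  rcases A.eq_empty_or_nonempty with rfl | ⟨a, ha⟩
  · simp [dirW]
  · simpa using inner_le_dirW r ha ha

theorem dirW_le (hA : A.Nonempty) {r : EuclideanSpace ℝ (Fin d)} {w : ℝ}
    (h : ∀ s ∈ A, ∀ v ∈ A, ‖r‖⁻¹ * ⟪r, s - v⟫ ≤ w) : dirW A r ≤ w := by
  obtain ⟨a, ha⟩ := hA
  refine csSup_le ⟨_, a, ha, a, ha, rfl⟩ ?_
  rintro _ ⟨s, hs, v, hv, rfl⟩
  rw [real_inner_smul_left]
  exact h s hs v hv

theorem width_nonneg (A : Finset (EuclideanSpace ℝ (Fin d))) : 0 ≤ width A := by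
  refine Real.sInf_nonneg ?_
  rintro _ ⟨r, -, -, rfl⟩
  exact dirW_nonneg A r

theorem width_le_dirW {r : EuclideanSpace ℝ (Fin d)} (hr : r ≠ 0)
    (hrA : r ∈ vectorSpan ℝ (A : Set (EuclideanSpace ℝ (Fin d)))) : width A ≤ dirW A r := by
  refine csInf_le ⟨0, ?_⟩ ⟨r, hr, by rwa [direction_affineSpan], rfl⟩
  rintro _ ⟨r, -, -, rfl⟩
  exact dirW_nonneg A r

theorem le_width (hA : 2 ≤ A.card) {w : ℝ}
    (h : ∀ r ≠ 0, r ∈ vectorSpan ℝ (A : Set (EuclideanSpace ℝ (Fin d))) → w ≤ dirW A r) :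
    w ≤ width A := by
  obtain ⟨a, ha, b, hb, hab⟩ := Finset.one_lt_card.1 hA
  refine le_csInf ⟨_, a - b, sub_ne_zero.2 hab, ?_, rfl⟩ ?_
  · rw [direction_affineSpan]
    exact vsub_mem_vectorSpan ℝ (Finset.mem_coe.2 ha) (Finset.mem_coe.2 hb)
  · rintro _ ⟨r, hr, hrA, rfl⟩
    exact h r hr (by rwa [direction_affineSpan] at hrA)

theorem width_eq_zero_of_card_lt_two (hA : A.card < 2) : width A = 0 := by
  have hs : (A : Set (EuclideanSpace ℝ (Fin d))).Subsingleton :=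
    Finset.card_le_one_iff_subsingleton.1 (by omega)
  have hempty : { w : ℝ | ∃ r : EuclideanSpace ℝ (Fin d), r ≠ 0 ∧
      r ∈ (affineSpan ℝ (A : Set (EuclideanSpace ℝ (Fin d)))).direction ∧ w = dirW A r } = ∅ := by
    rw [Set.eq_empty_iff_forall_notMem]
    rintro _ ⟨r, hr, hrA, -⟩
    rw [direction_affineSpan, vectorSpan_of_subsingleton ℝ hs] at hrA
    exact hr ((Submodule.mem_bot ℝ).1 hrA)
  rw [width, hempty, Real.sInf_empty]

theorem minwidth_eq_zero_of_card_lt_two (hA : A.card < 2) : minwidth A = 0 := by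
  have hempty : { w : ℝ | ∃ B : Finset (EuclideanSpace ℝ (Fin d)),
      B ⊆ A ∧ 2 ≤ B.card ∧ w = width B } = ∅ := by
    rw [Set.eq_empty_iff_forall_notMem]
    rintro _ ⟨B, hB, hcard, -⟩
    have := Finset.card_le_card hB
    omega
  rw [minwidth, hempty, Real.sInf_empty]

/-- If `r` extends `r₀` in the sense that they agree on differences of points of `S`, then `r`
is at least as long as `r₀`. -/
theorem norm_le_norm_of_inner_sub_eq {E : Type*} [NormedAddCommGroup E] [InnerProductSpace ℝ E]
    {S : Set E} {r r₀ : E} (hr₀ : r₀ ∈ vectorSpan ℝ S)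
    (h : ∀ s ∈ S, ∀ v ∈ S, ⟪r, s - v⟫ = ⟪r₀, s - v⟫) : ‖r₀‖ ≤ ‖r‖ := by
  have hle : vectorSpan ℝ S ≤ LinearMap.ker (innerSL ℝ (r - r₀)).toLinearMap := by
    refine Submodule.span_le.2 ?_
    rintro _ ⟨s, hs, v, hv, rfl⟩
    simpa [inner_sub_left, sub_eq_zero] using h s hs v hv
  have horth : ⟪r, r₀⟫ = ‖r₀‖ * ‖r₀‖ := by
    have := hle hr₀
    rw [LinearMap.mem_ker] at this
    have h0 : ⟪r - r₀, r₀⟫ = 0 := this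
    rw [inner_sub_left, real_inner_self_eq_norm_mul_norm] at h0
    linarith
  by_contra! hlt
  have hpos : 0 < ‖r₀‖ := (norm_nonneg r).trans_lt hlt
  nlinarith [real_inner_le_norm r r₀]

theorem width_le_width_of_subset
    (hA : AffineIndependent ℝ (fun a : A => (a : EuclideanSpace ℝ (Fin d)))) (hsub : A₀ ⊆ A)
    (hcard : 2 ≤ A₀.card) : width A ≤ width A₀ := by
  classical
  refine le_width hcard fun r₀ hr₀ hr₀A => ?_
  obtain ⟨a₀, ha₀⟩ : A₀.Nonempty := Finset.card_pos.1 (by omega)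
  -- Collapse the vertices outside `A₀` to `a₀`.
  let π (a : EuclideanSpace ℝ (Fin d)) := if a ∈ A₀ then a else a₀
  have hπmem (a) : π a ∈ A₀ := by
    by_cases h : a ∈ A₀ <;> simp [π, h, ha₀]
  obtain ⟨r, hrA, hr⟩ := hA.exists_inner_sub_eq fun a => ⟪r₀, π a⟫
  have hrπ : ∀ s ∈ A, ∀ v ∈ A, ⟪r, s - v⟫ = ⟪r₀, π s - π v⟫ := fun s hs v hv => by
    rw [inner_sub_right r₀]
    exact hr ⟨s, hs⟩ ⟨v, hv⟩
  have hnorm : ‖r₀‖ ≤ ‖r‖ := norm_le_norm_of_inner_sub_eq hr₀A fun s hs v hv => by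
    have hs' : s ∈ A₀ := hs
    have hv' : v ∈ A₀ := hv
    simpa [π, hs', hv'] using hrπ s (hsub hs) v (hsub hv)
  have hpos : 0 < ‖r₀‖ := norm_pos_iff.2 hr₀
  refine (width_le_dirW (norm_pos_iff.1 (hpos.trans_le hnorm)) (by simpa using hrA)).trans
    (dirW_le ⟨a₀, hsub ha₀⟩ fun s hs v hv => ?_)
  rw [hrπ s hs v hv]
  rcases le_total ⟪r₀, π s - π v⟫ 0 with h | h
  · exact (mul_nonpos_of_nonneg_of_nonpos (by positivity) h).trans (dirW_nonneg A₀ r₀)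
  · refine le_trans ?_ (inner_le_dirW r₀ (hπmem s) (hπmem v))
    gcongr

end

/-- Lemma: if `A` is the vertex set of a simplex in `ℝ^d` (a set of affinely independent
points) and `A₀ ⊆ A` has at least two points, then `width A ≤ width A₀`. In particular
`minwidth A = width A`. -/
theorem stmt4 (d : ℕ) (A : Finset (EuclideanSpace ℝ (Fin d)))
    (hA : AffineIndependent ℝ (fun a : A => (a : EuclideanSpace ℝ (Fin d)))) :
    (∀ A₀ : Finset (EuclideanSpace ℝ (Fin d)), A₀ ⊆ A → 2 ≤ A₀.card →
      width A ≤ width A₀) ∧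
    minwidth A = width A := by
  refine ⟨fun A₀ hsub hcard => width_le_width_of_subset hA hsub hcard, ?_⟩
  rcases lt_or_ge A.card 2 with hcard | hcard
  · rw [width_eq_zero_of_card_lt_two hcard, minwidth_eq_zero_of_card_lt_two hcard]
  apply le_antisymm
  · refine csInf_le ⟨0, ?_⟩ ⟨A, subset_rfl, hcard, rfl⟩
    rintro _ ⟨B, -, -, rfl⟩
    exact width_nonneg B
  · refine le_csInf ⟨_, A, subset_rfl, hcard, rfl⟩ ?_
    rintro _ ⟨B, hB, hBcard, rfl⟩
    exact width_le_width_of_subset hA hB hBcard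
end

section
/- Let A ⊆ ℝ^d be a finite set with at least two points such that conv(A) has at least one facet (dim(aff(conv A)) ≥ 1). Then vf(conv(A)) ≥ PWidth(A). -/
/-- `x` is a proper convex combination of all elements of `T`. -/
def ProperComb {d : ℕ} (T : Finset (EuclideanSpace ℝ (Fin d)))
    (x : EuclideanSpace ℝ (Fin d)) : Prop :=
  ∃ w : EuclideanSpace ℝ (Fin d) → ℝ,
    (∀ y ∈ T, 0 < w y) ∧ ∑ y ∈ T, w y = 1 ∧ ∑ y ∈ T, w y • y = x

/-- The pyramidal directional width of the finite set `A` with respect to direction `r`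
and base point `x`. -/
noncomputable def PDirW {d : ℕ} (A : Finset (EuclideanSpace ℝ (Fin d)))
    (r x : EuclideanSpace ℝ (Fin d)) : ℝ :=
  sInf { w : ℝ | ∃ T : Finset (EuclideanSpace ℝ (Fin d)), T ⊆ A ∧ ProperComb T x ∧
    w = sSup { p : ℝ | ∃ s ∈ A, ∃ v ∈ T, p = (inner ℝ (‖r‖⁻¹ • r) (s - v) : ℝ) } }

open Classical in
/-- The pyramidal width of a finite set `A`: the minimum of the pyramidal directional width
over nonempty faces `K` of `conv A`, base points `x ∈ K`, and nonzero feasible directions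
`r ∈ cone(K - x)`. -/
noncomputable def PWidth {d : ℕ} (A : Finset (EuclideanSpace ℝ (Fin d))) : ℝ :=
  sInf { w : ℝ | ∃ K : Set (EuclideanSpace ℝ (Fin d)),
    IsExtreme ℝ (convexHull ℝ (A : Set (EuclideanSpace ℝ (Fin d)))) K ∧ Convex ℝ K ∧
    K.Nonempty ∧ ∃ x ∈ K, ∃ r : EuclideanSpace ℝ (Fin d), r ≠ 0 ∧
      (∃ c : ℝ, 0 ≤ c ∧ ∃ y ∈ K, r = c • (y - x)) ∧
      w = PDirW (A.filter (· ∈ K)) r x }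

section

variable {d : ℕ}

local notation "𝔼" => EuclideanSpace ℝ (Fin d)

/-- The points of `A` maximizing the linear functional `⟪g, ·⟫`. -/
def maximizers (A : Set 𝔼) (g : 𝔼) : Set 𝔼 :=
  {a ∈ A | ∀ b ∈ A, inner ℝ g b ≤ inner ℝ g a}

theorem inner_le_of_mem_convexHull {A : Set 𝔼} {g : 𝔼} {c : ℝ} (h : ∀ b ∈ A, inner ℝ g b ≤ c)
    {y : 𝔼} (hy : y ∈ convexHull ℝ A) : inner ℝ g y ≤ c :=
  convexHull_min (t := {z | innerSL ℝ g z ≤ c}) h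
    (convex_halfSpace_le (innerSL ℝ g).toLinearMap.isLinear c) hy

theorem maximizers_subset_maximizers_convexHull (A : Set 𝔼) (g : 𝔼) :
    maximizers A g ⊆ maximizers (convexHull ℝ A) g :=
  fun _ ha => ⟨subset_convexHull ℝ A ha.1, fun _ hy => inner_le_of_mem_convexHull ha.2 hy⟩

theorem maximizers_nonempty {A : Set 𝔼} (hfin : A.Finite) (hA : A.Nonempty) (g : 𝔼) :
    (maximizers A g).Nonempty := by
  obtain ⟨p, hp, hmax⟩ := hfin.exists_maximalFor (fun a => inner ℝ g a) A hA
  exact ⟨p, hp, fun b hb => le_of_not_gt fun h => absurd (hmax hb h.le) (not_le.2 h)⟩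

theorem isExposed_maximizers (P : Set 𝔼) (g : 𝔼) : IsExposed ℝ P (maximizers P g) :=
  fun _ => ⟨innerSL ℝ g, rfl⟩

/-- A vector that is orthogonal to all differences of points of `s` is orthogonal to the
direction of its affine span. -/
theorem mem_orthogonal_direction_affineSpan {s : Set 𝔼} {u p : 𝔼} (hp : p ∈ s)
    (h : ∀ a ∈ s, inner ℝ u (a - p) = (0 : ℝ)) : u ∈ (affineSpan ℝ s).directionᗮ := by
  rw [direction_affineSpan, vectorSpan_eq_span_vsub_set_right ℝ hp, Submodule.mem_orthogonal']
  intro w hw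
  induction hw using Submodule.span_induction with
  | mem x hx => obtain ⟨a, ha, rfl⟩ := hx; exact h a ha
  | zero => simp
  | add x y _ _ hx hy => rw [inner_add_right, hx, hy, add_zero]
  | smul c x _ hx => rw [inner_smul_right, hx, mul_zero]

/-- If `u` is constant on the face of `A` exposed by `g` but is larger somewhere else on `A`, then
`g` can be tilted towards `u` until it exposes a strictly larger face. -/
theorem exists_maximizers_ssubset {A : Set 𝔼} (hfin : A.Finite) {g u p : 𝔼}
    (hp : p ∈ maximizers A g) (hu : ∀ a ∈ maximizers A g, inner ℝ u (a - p) = (0 : ℝ))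
    {q : 𝔼} (hq : q ∈ A) (hqu : (0 : ℝ) < inner ℝ u (q - p)) :
    ∃ t : ℝ, 0 < t ∧ maximizers A g ⊂ maximizers A (g + t • u) := by
  have hpos : ∀ a ∈ A, (0 : ℝ) < inner ℝ u (a - p) → (0 : ℝ) < inner ℝ g (p - a) := by
    intro a ha hau
    rw [inner_sub_right, sub_pos]
    refine lt_of_le_of_ne (hp.2 a ha) fun h => hau.ne' (hu a ⟨ha, fun b hb => ?_⟩)
    exact (hp.2 b hb).trans h.ge
  obtain ⟨a, ⟨ha, hau⟩, hmin⟩ := Set.exists_min_image {a ∈ A | (0 : ℝ) < inner ℝ u (a - p)}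
    (fun a => (inner ℝ g (p - a) / inner ℝ u (a - p) : ℝ)) (hfin.subset (Set.sep_subset _ _))
    ⟨q, hq, hqu⟩
  set t : ℝ := inner ℝ g (p - a) / inner ℝ u (a - p)
  have ht0 : 0 < t := div_pos (hpos a ha hau) hau
  have htop : ∀ b ∈ A, inner ℝ (g + t • u) b ≤ (inner ℝ (g + t • u) p : ℝ) := by
    intro b hb
    have key : t * inner ℝ u (b - p) ≤ inner ℝ g (p - b) := by
      by_cases hbu : (0 : ℝ) < inner ℝ u (b - p)
      · exact (le_div_iff₀ hbu).1 (hmin b ⟨hb, hbu⟩)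
      · refine (mul_nonpos_of_nonneg_of_nonpos ht0.le (not_lt.1 hbu)).trans ?_
        rw [inner_sub_right, sub_nonneg]
        exact hp.2 b hb
    simp only [inner_sub_right] at key
    simp only [inner_add_left, real_inner_smul_left]
    linarith
  refine ⟨t, ht0, fun b hb => ⟨hb.1, fun c hc => (htop c hc).trans ?_⟩, fun hsub => ?_⟩
  · have h1 := hu b hb
    have h2 := hb.2 p hp.1
    rw [inner_sub_right, sub_eq_zero] at h1
    simp only [inner_add_left, real_inner_smul_left]
    rw [h1]
    linarith
  · have hmem : a ∈ maximizers A (g + t • u) := by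
      refine ⟨ha, fun c hc => (htop c hc).trans ?_⟩
      have : t * inner ℝ u (a - p) = inner ℝ g (p - a) := div_mul_cancel₀ _ hau.ne'
      simp only [inner_sub_right] at this
      simp only [inner_add_left, real_inner_smul_left]
      linarith
    exact hau.ne' (hu a (hsub hmem))

theorem orthogonal_direction_maximizers {P : Set 𝔼} {g : 𝔼} (hne : (maximizers P g).Nonempty) :
    g ∈ (affineSpan ℝ (maximizers P g)).directionᗮ := by
  obtain ⟨p, hp⟩ := hne
  refine mem_orthogonal_direction_affineSpan hp fun a ha => ?_
  rw [inner_sub_right, sub_eq_zero]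
  exact le_antisymm (hp.2 a ha.1) (ha.2 p hp.1)

theorem sup_span_le_and_finrank_eq {V D : Submodule ℝ 𝔼} {g : 𝔼} (hVD : V ≤ D) (hgD : g ∈ D)
    (hg0 : g ≠ 0) (hg : g ∈ Vᗮ) :
    V ⊔ Submodule.span ℝ {g} ≤ D ∧
      Module.finrank ℝ ↥(V ⊔ Submodule.span ℝ {g}) = Module.finrank ℝ V + 1 := by
  refine ⟨sup_le hVD ((Submodule.span_singleton_le_iff_mem _ _).2 hgD),
    Submodule.finrank_sup_span_singleton fun hgV => hg0 ?_⟩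
  exact inner_self_eq_zero.1 (Submodule.inner_right_of_mem_orthogonal hgV hg)

/-- A face exposed by `g` whose codimension exceeds one is properly contained in another one. -/
theorem exists_larger_maximizers {A : Set 𝔼} (hfin : A.Finite) (hA : A.Nonempty) {g : 𝔼}
    (hgD : g ∈ (affineSpan ℝ A).direction) (hg0 : g ≠ 0)
    (hlt : Module.finrank ℝ (affineSpan ℝ (maximizers (convexHull ℝ A) g)).direction + 1 <
      Module.finrank ℝ (affineSpan ℝ A).direction) :
    ∃ k ∈ (affineSpan ℝ A).direction, k ≠ 0 ∧ maximizers A g ⊂ maximizers A k := by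
  obtain ⟨p, hp⟩ := maximizers_nonempty hfin hA g
  have hsub := maximizers_subset_maximizers_convexHull A g
  have hVD : (affineSpan ℝ (maximizers (convexHull ℝ A) g)).direction ≤
      (affineSpan ℝ A).direction := by
    rw [← affineSpan_convexHull A]
    exact AffineSubspace.direction_le (affineSpan_mono ℝ fun x hx => hx.1)
  obtain ⟨hWD, hW⟩ :=
    sup_span_le_and_finrank_eq hVD hgD hg0 (orthogonal_direction_maximizers ⟨p, hsub hp⟩)
  have hsum := Submodule.finrank_add_inf_finrank_orthogonal hWD
  rw [hW] at hsum
  obtain ⟨u, hu, hu0⟩ := Submodule.exists_mem_ne_zero_of_ne_bot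
    (Submodule.one_le_finrank_iff.1 (Nat.pos_of_lt_add_right (hlt.trans_eq hsum.symm)))
  have huV : u ∈ (affineSpan ℝ (maximizers (convexHull ℝ A) g)).directionᗮ :=
    Submodule.orthogonal_le le_sup_left hu.1
  have hug : inner ℝ g u = (0 : ℝ) := Submodule.inner_right_of_mem_orthogonal
    (Submodule.mem_sup_right (Submodule.mem_span_singleton_self g)) hu.1
  have hconst : ∀ a ∈ maximizers A g, inner ℝ u (a - p) = (0 : ℝ) := fun a ha =>
    Submodule.inner_left_of_mem_orthogonal (AffineSubspace.vsub_mem_direction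
      (subset_affineSpan ℝ _ (hsub ha)) (subset_affineSpan ℝ _ (hsub hp))) huV
  obtain ⟨q, hq, hqu⟩ : ∃ q ∈ A, inner ℝ u (q - p) ≠ (0 : ℝ) := by
    by_contra! h
    exact hu0 (inner_self_eq_zero.1 (Submodule.inner_right_of_mem_orthogonal hu.2
      (mem_orthogonal_direction_affineSpan hp.1 h)))
  have tilt : ∀ w : 𝔼, w ∈ (affineSpan ℝ A).direction → inner ℝ g w = (0 : ℝ) →
      (∀ a ∈ maximizers A g, inner ℝ w (a - p) = (0 : ℝ)) → (0 : ℝ) < inner ℝ w (q - p) →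
      ∃ k ∈ (affineSpan ℝ A).direction, k ≠ 0 ∧ maximizers A g ⊂ maximizers A k := by
    intro w hwD hgw hw hwq
    obtain ⟨t, -, hss⟩ := exists_maximizers_ssubset hfin hp hw hq hwq
    refine ⟨g + t • w, add_mem hgD (Submodule.smul_mem _ _ hwD), fun h => hg0 ?_, hss⟩
    have := congrArg (fun z => (inner ℝ g z : ℝ)) h
    simpa [inner_add_right, real_inner_smul_right, hgw] using this
  rcases hqu.lt_or_gt with h | h
  · exact tilt (-u) (neg_mem hu.2) (by simp [hug])
      (fun a ha => by rw [inner_neg_left, hconst a ha, neg_zero]) (by rw [inner_neg_left]; linarith)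
  · exact tilt u hu.2 hug hconst h

theorem exists_isFacetOf {A : Set 𝔼} (hfin : A.Finite)
    (hdim : 1 ≤ Module.finrank ℝ (affineSpan ℝ (convexHull ℝ A)).direction) :
    ∃ F, IsFacetOf (convexHull ℝ A) F := by
  rw [affineSpan_convexHull] at hdim
  obtain ⟨g₀, hg₀, hg₀0⟩ :=
    Submodule.exists_mem_ne_zero_of_ne_bot (Submodule.one_le_finrank_iff.1 hdim)
  have hA : A.Nonempty := by
    rw [Set.nonempty_iff_ne_empty]
    rintro rfl
    simp at hdim
  let N : Set ℕ := {n | ∃ g ∈ (affineSpan ℝ A).direction, g ≠ 0 ∧ (maximizers A g).ncard = n}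
  have hN : BddAbove N := by
    refine ⟨A.ncard, ?_⟩
    rintro _ ⟨g, -, -, rfl⟩
    exact Set.ncard_le_ncard (Set.sep_subset _ _) hfin
  obtain ⟨g, hgD, hg0, hg⟩ : sSup N ∈ N := Nat.sSup_mem ⟨_, g₀, hg₀, hg₀0, rfl⟩ hN
  have hne := (maximizers_nonempty hfin hA g).mono (maximizers_subset_maximizers_convexHull A g)
  refine ⟨maximizers (convexHull ℝ A) g, isExposed_maximizers _ _, hne, ?_⟩
  have hVD : (affineSpan ℝ (maximizers (convexHull ℝ A) g)).direction ≤
      (affineSpan ℝ A).direction := by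
    rw [← affineSpan_convexHull A]
    exact AffineSubspace.direction_le (affineSpan_mono ℝ fun x hx => hx.1)
  obtain ⟨hWD, hW⟩ := sup_span_le_and_finrank_eq hVD hgD hg0 (orthogonal_direction_maximizers hne)
  rw [affineSpan_convexHull]
  refine le_antisymm (hW ▸ Submodule.finrank_mono hWD) (le_of_not_gt fun hlt => ?_)
  obtain ⟨k, hkD, hk0, hss⟩ := exists_larger_maximizers hfin hA hgD hg0 hlt
  have h1 := Set.ncard_lt_ncard hss (hfin.subset (Set.sep_subset _ _))
  have h2 : (maximizers A k).ncard ≤ sSup N := le_csSup hN ⟨k, hkD, hk0, rfl⟩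
  omega

theorem convexHull_extremePoints_of_finite {P : Set 𝔼} (hP : IsCompact P) (hconv : Convex ℝ P)
    (hfin : (P.extremePoints ℝ).Finite) : convexHull ℝ (P.extremePoints ℝ) = P := by
  rw [← (hfin.isClosed_convexHull ℝ).closure_eq, closure_convexHull_extremePoints hP hconv]

/-- From a convex combination of `T` with positive weights one can move inside `conv T` in every
direction parallel to the affine span of `T`. -/
theorem exists_pos_add_smul_mem_convexHull {T : Finset 𝔼} {x u : 𝔼} (hx : ProperComb T x)
    (hu : u ∈ vectorSpan ℝ (T : Set 𝔼)) :
    ∃ ε : ℝ, 0 < ε ∧ x + ε • u ∈ convexHull ℝ (T : Set 𝔼) := by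
  classical
  obtain ⟨w, hw0, hw1, rfl⟩ := hx
  have hcoef : ∃ c : 𝔼 → ℝ, ∑ y ∈ T, c y = 0 ∧ ∑ y ∈ T, c y • y = u := by
    rw [vectorSpan_def] at hu
    induction hu using Submodule.span_induction with
    | mem z hz =>
      obtain ⟨a, ha, b, hb, rfl⟩ := Set.mem_vsub.1 hz
      rw [Finset.mem_coe] at ha hb
      refine ⟨fun y => (if y = a then 1 else 0) - (if y = b then 1 else 0), ?_, ?_⟩
      · simp [Finset.sum_sub_distrib, ha, hb]
      · simp [sub_smul, Finset.sum_sub_distrib, ite_smul, ha, hb]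
    | zero => exact ⟨0, by simp, by simp⟩
    | add y z _ _ hy hz =>
      obtain ⟨c, hc, rfl⟩ := hy
      obtain ⟨e, he, rfl⟩ := hz
      exact ⟨c + e, by simp [Finset.sum_add_distrib, hc, he],
        by simp [add_smul, Finset.sum_add_distrib]⟩
    | smul k z _ hz =>
      obtain ⟨c, hc, rfl⟩ := hz
      exact ⟨k • c, by simp [← Finset.mul_sum, hc], by simp [mul_smul, Finset.smul_sum]⟩
  obtain ⟨c, hc, rfl⟩ := hcoef
  have hev : ∀ᶠ ε : ℝ in nhdsWithin 0 (Set.Ioi 0), ∀ y ∈ T, 0 < w y + ε * c y := by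
    rw [Filter.eventually_all_finset]
    intro y hy
    refine Filter.Eventually.filter_mono nhdsWithin_le_nhds ?_
    have hcont : Continuous fun ε : ℝ => w y + ε * c y := by fun_prop
    exact hcont.continuousAt.eventually_const_lt (by simpa using hw0 y hy)
  obtain ⟨ε, hε, hε0⟩ := (hev.and self_mem_nhdsWithin).exists
  refine ⟨ε, hε0, ?_⟩
  have hmem := (convex_convexHull ℝ (T : Set 𝔼)).sum_mem (t := T) (w := fun y => w y + ε * c y)
    (z := id) (fun y hy => (hε y hy).le)
    (by rw [Finset.sum_add_distrib, ← Finset.mul_sum, hc, hw1]; ring)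
    (fun y hy => subset_convexHull ℝ _ hy)
  simpa [add_smul, Finset.sum_add_distrib, Finset.smul_sum, mul_smul] using hmem

theorem exists_properComb {T : Finset 𝔼} (hT : T.Nonempty) : ∃ x, ProperComb T x := by
  have hpos : (0 : ℝ) < T.card := by exact_mod_cast hT.card_pos
  exact ⟨_, fun _ => (T.card : ℝ)⁻¹, fun _ _ => inv_pos.2 hpos, by simp [hpos.ne'], rfl⟩

theorem ProperComb.mem_convexHull {T : Finset 𝔼} {x : 𝔼} (h : ProperComb T x) :
    x ∈ convexHull ℝ (T : Set 𝔼) := by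
  obtain ⟨w, hw0, hw1, rfl⟩ := h
  exact (convex_convexHull ℝ _).sum_mem (fun y hy => (hw0 y hy).le) hw1
    fun y hy => subset_convexHull ℝ _ hy

theorem ProperComb.nonempty {T : Finset 𝔼} {x : 𝔼} (h : ProperComb T x) : T.Nonempty := by
  obtain ⟨w, -, hw1, -⟩ := h
  by_contra hT
  simp [Finset.not_nonempty_iff_eq_empty.1 hT] at hw1

theorem sSup_inner_nonneg {A T : Finset 𝔼} (hTA : T ⊆ A) (hT : T.Nonempty) (r : 𝔼) :
    0 ≤ sSup {p : ℝ | ∃ s ∈ A, ∃ v ∈ T, p = (inner ℝ (‖r‖⁻¹ • r) (s - v) : ℝ)} := by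
  have hfin : {p : ℝ | ∃ s ∈ A, ∃ v ∈ T, p = (inner ℝ (‖r‖⁻¹ • r) (s - v) : ℝ)}.Finite := by
    refine ((A.finite_toSet.prod T.finite_toSet).image
      fun z => (inner ℝ (‖r‖⁻¹ • r) (z.1 - z.2) : ℝ)).subset ?_
    rintro p ⟨s, hs, v, hv, rfl⟩
    exact ⟨(s, v), ⟨hs, hv⟩, rfl⟩
  obtain ⟨v, hv⟩ := hT
  exact le_csSup hfin.bddAbove ⟨v, hTA hv, v, hv, by simp⟩

theorem PDirW_nonneg (A : Finset 𝔼) (r x : 𝔼) : 0 ≤ PDirW A r x := by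
  refine Real.sInf_nonneg ?_
  rintro _ ⟨T, hTA, hT, rfl⟩
  exact sSup_inner_nonneg hTA hT.nonempty r

theorem PDirW_le {A T : Finset 𝔼} {r x : 𝔼} {c : ℝ} (hTA : T ⊆ A) (hT : ProperComb T x)
    (hc : 0 ≤ c) (h : ∀ s ∈ A, ∀ v ∈ T, inner ℝ (‖r‖⁻¹ • r) (s - v) ≤ c) : PDirW A r x ≤ c := by
  unfold PDirW
  refine le_trans (csInf_le ⟨0, ?_⟩ ⟨T, hTA, hT, rfl⟩) (Real.sSup_le ?_ hc)
  · rintro _ ⟨S, hSA, hS, rfl⟩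
    exact sSup_inner_nonneg hSA hS.nonempty r
  · rintro _ ⟨s, hs, v, hv, rfl⟩
    exact h s hs v hv

/-- The pyramidal width is at most any pyramidal directional width taken with respect to the
improper face. -/
theorem PWidth_le_PDirW {A : Finset 𝔼} {x y r : 𝔼} {c : ℝ} (hx : x ∈ convexHull ℝ (A : Set 𝔼))
    (hy : y ∈ convexHull ℝ (A : Set 𝔼)) (hr : r ≠ 0) (hc : 0 ≤ c) (hrc : r = c • (y - x)) :
    PWidth A ≤ PDirW A r x := by
  classical
  refine csInf_le ⟨0, ?_⟩ ⟨convexHull ℝ (A : Set 𝔼), IsExtreme.refl ℝ _, convex_convexHull ℝ _,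
    ⟨x, hx⟩, x, hx, r, hr, ⟨c, hc, y, hy, hrc⟩, ?_⟩
  · rintro _ ⟨K, -, -, -, x, -, r, -, -, rfl⟩
    exact PDirW_nonneg _ _ _
  · rw [Finset.filter_true_of_mem fun a ha => subset_convexHull ℝ _ ha]

theorem IsFacetOf.convexHull_inter {A F : Set 𝔼} (hfin : A.Finite)
    (hF : IsFacetOf (convexHull ℝ A) F) : convexHull ℝ (A ∩ F) = F := by
  obtain ⟨hexp, -, -⟩ := hF
  have hconv := hexp.convex (convex_convexHull ℝ A)
  have hsub : F.extremePoints ℝ ⊆ A ∩ F := fun x hx =>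
    ⟨extremePoints_convexHull_subset (hexp.isExtreme.extremePoints_subset_extremePoints hx),
      extremePoints_subset hx⟩
  refine (convexHull_min Set.inter_subset_right hconv).antisymm ?_
  conv_lhs => rw [← convexHull_extremePoints_of_finite
    (hexp.isCompact (hfin.isCompact_convexHull ℝ)) hconv
    (hfin.subset (hsub.trans Set.inter_subset_left))]
  exact convexHull_mono hsub

theorem IsFacetOf.exists_extremePoint_notMem {A F : Set 𝔼} (hfin : A.Finite)
    (hF : IsFacetOf (convexHull ℝ A) F) : ∃ v ∈ (convexHull ℝ A).extremePoints ℝ, v ∉ F := by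
  by_contra! h
  obtain ⟨hexp, -, hrank⟩ := hF
  have hle : convexHull ℝ A ⊆ F := by
    rw [← convexHull_extremePoints_of_finite (hfin.isCompact_convexHull ℝ) (convex_convexHull ℝ A)
      (hfin.subset extremePoints_convexHull_subset)]
    exact convexHull_min h (hexp.convex (convex_convexHull ℝ A))
  rw [hexp.subset.antisymm hle] at hrank
  omega

theorem PWidth_le_infDist {A : Finset 𝔼} {F : Set 𝔼}
    (hF : IsFacetOf (convexHull ℝ (A : Set 𝔼)) F) {v : 𝔼} (hvA : v ∈ A) (hvF : v ∉ F) :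
    PWidth A ≤ Metric.infDist v (affineSpan ℝ F : Set 𝔼) := by
  classical
  have hhull := hF.convexHull_inter A.finite_toSet
  obtain ⟨hexp, hne, hrank⟩ := hF
  obtain ⟨p, hp⟩ := hne
  obtain ⟨l, hl⟩ := hexp ⟨p, hp⟩
  have hvP : v ∈ convexHull ℝ (A : Set 𝔼) := subset_convexHull ℝ _ hvA
  have hlp : ∀ y ∈ convexHull ℝ (A : Set 𝔼), l y ≤ l p := by rw [hl] at hp; exact hp.2
  have hlv : l v < l p := by
    refine lt_of_le_of_ne (hlp v hvP) fun h => hvF ?_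
    rw [hl]
    exact ⟨hvP, fun y hy => (hlp y hy).trans h.ge⟩
  have hlF : ∀ y ∈ F, l y = l p := fun y hy =>
    le_antisymm (hlp y (hexp.subset hy)) (by rw [hl] at hy; exact hy.2 p (hexp.subset hp))
  have hlV : ∀ z ∈ (affineSpan ℝ F).direction, l z = 0 := by
    intro z hz
    rw [direction_affineSpan, vectorSpan_eq_span_vsub_set_right ℝ hp] at hz
    refine (Submodule.span_le (p := LinearMap.ker l.toLinearMap)).2 ?_ hz
    rintro _ ⟨a, ha, rfl⟩
    simp [hlF a ha]
  have hpaff : p ∈ affineSpan ℝ F := subset_affineSpan ℝ F hp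
  have : Nonempty (affineSpan ℝ F) := ⟨⟨p, hpaff⟩⟩
  set q : 𝔼 := ↑(EuclideanGeometry.orthogonalProjection (affineSpan ℝ F) v)
  have hqaff : q ∈ affineSpan ℝ F := EuclideanGeometry.orthogonalProjection_mem v
  set r : 𝔼 := q - v with hrdef
  have hrorth : r ∈ (affineSpan ℝ F).directionᗮ :=
    EuclideanGeometry.orthogonalProjection_vsub_mem_direction_orthogonal _ v
  have hdist : Metric.infDist v (affineSpan ℝ F : Set 𝔼) = ‖r‖ := by
    rw [← EuclideanGeometry.dist_orthogonalProjection_eq_infDist, dist_comm, dist_eq_norm]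
  have hlq : l q = l p := by
    have := hlV _ (AffineSubspace.vsub_mem_direction hqaff hpaff)
    rwa [vsub_eq_sub, map_sub, sub_eq_zero] at this
  have hlr : 0 < l r := by rw [hrdef, map_sub, hlq]; linarith
  have hr0 : r ≠ 0 := by
    intro h
    rw [h, map_zero] at hlr
    exact hlr.false
  have hFP : affineSpan ℝ F ≤ affineSpan ℝ (convexHull ℝ (A : Set 𝔼)) :=
    affineSpan_mono ℝ hexp.subset
  obtain ⟨hWD, hW⟩ := sup_span_le_and_finrank_eq (g := r) (AffineSubspace.direction_le hFP)
    (AffineSubspace.vsub_mem_direction (hFP hqaff) (subset_affineSpan ℝ _ hvP)) hr0 hrorth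
  have hWeq := Submodule.eq_of_le_of_finrank_eq hWD (hW.trans hrank)
  have hflat : ∀ y ∈ F, inner ℝ r (y - q) = (0 : ℝ) := fun y hy =>
    Submodule.inner_left_of_mem_orthogonal
      (AffineSubspace.vsub_mem_direction (subset_affineSpan ℝ F hy) hqaff) hrorth
  have hbelow : ∀ s ∈ A, inner ℝ r (s - q) ≤ (0 : ℝ) := by
    intro s hs
    have hsP : s ∈ convexHull ℝ (A : Set 𝔼) := subset_convexHull ℝ _ hs
    have hsD : s - q ∈ (affineSpan ℝ (convexHull ℝ (A : Set 𝔼))).direction :=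
      AffineSubspace.vsub_mem_direction (subset_affineSpan ℝ _ hsP) (hFP hqaff)
    rw [← hWeq] at hsD
    obtain ⟨z, hz, _, hk, hsum⟩ := Submodule.mem_sup.1 hsD
    obtain ⟨k, rfl⟩ := Submodule.mem_span_singleton.1 hk
    have hk0 : k ≤ 0 := by
      have h1 := congrArg l hsum
      rw [map_add, map_smul, hlV z hz, zero_add, smul_eq_mul, map_sub l s q, hlq] at h1
      have h2 := hlp s hsP
      by_contra! hk
      have := mul_pos hk hlr
      linarith
    rw [← hsum, inner_add_right, Submodule.inner_left_of_mem_orthogonal hz hrorth, zero_add,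
      real_inner_smul_right]
    exact mul_nonpos_of_nonpos_of_nonneg hk0 real_inner_self_nonneg
  let T : Finset 𝔼 := insert v (A.filter (· ∈ F))
  have hTA : T ⊆ A := Finset.insert_subset hvA (Finset.filter_subset _ _)
  obtain ⟨x, hx⟩ := exists_properComb (T := T) ⟨v, Finset.mem_insert_self _ _⟩
  have hrT : r ∈ vectorSpan ℝ (T : Set 𝔼) := by
    rw [← direction_affineSpan]
    refine AffineSubspace.vsub_mem_direction ?_
      (subset_affineSpan ℝ _ (Finset.mem_coe.2 (Finset.mem_insert_self _ _)))
    rw [← hhull, affineSpan_convexHull] at hqaff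
    refine affineSpan_mono ℝ ?_ hqaff
    rintro a ⟨haA, haF⟩
    exact Finset.mem_coe.2 (Finset.mem_insert_of_mem (Finset.mem_filter.2 ⟨haA, haF⟩))
  obtain ⟨ε, hε, hmem⟩ := exists_pos_add_smul_mem_convexHull hx hrT
  have hTP := convexHull_mono (𝕜 := ℝ) (Finset.coe_subset.2 hTA)
  rw [hdist]
  refine (PWidth_le_PDirW (hTP hx.mem_convexHull) (hTP hmem) hr0 (inv_nonneg.2 hε.le) ?_).trans
    (PDirW_le hTA hx (norm_nonneg r) fun s hs y hy => ?_)
  · rw [add_sub_cancel_left, inv_smul_smul₀ hε.ne']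
  · have hnorm : 0 < ‖r‖ := norm_pos_iff.2 hr0
    rw [real_inner_smul_left, inv_mul_le_iff₀ hnorm, ← real_inner_self_eq_norm_mul_norm,
      ← sub_sub_sub_cancel_right s y q, inner_sub_right r (s - q)]
    have h1 := hbelow s hs
    rcases Finset.mem_insert.1 hy with rfl | hyF
    · have : y - q = -r := by rw [hrdef, neg_sub]
      rw [this, inner_neg_right]
      linarith
    · rw [hflat y (Finset.mem_filter.1 hyF).2, sub_zero]
      exact h1.trans real_inner_self_nonneg

end

/-- Proposition: for a finite set `A ⊆ ℝ^d` with at least two points whose convex hull has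
affine dimension at least one, `vf(conv A) ≥ PWidth A`. -/
theorem stmt5 (d : ℕ) (A : Finset (EuclideanSpace ℝ (Fin d))) (hcard : 2 ≤ A.card)
    (hdim : 1 ≤ Module.finrank ℝ
      (affineSpan ℝ (convexHull ℝ (A : Set (EuclideanSpace ℝ (Fin d))))).direction) :
    PWidth A ≤ vf (convexHull ℝ (A : Set (EuclideanSpace ℝ (Fin d)))) := by
  refine le_csInf ?_ ?_
  · obtain ⟨F, hF⟩ := exists_isFacetOf A.finite_toSet hdim
    exact ⟨_, F, hF, rfl⟩
  · rintro _ ⟨F, hF, rfl⟩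
    refine le_csInf ?_ ?_
    · obtain ⟨v, hv, hvF⟩ := hF.exists_extremePoint_notMem A.finite_toSet
      exact ⟨_, v, hv, hvF, rfl⟩
    · rintro _ ⟨v, hv, hvF, rfl⟩
      exact PWidth_le_infDist hF (Finset.mem_coe.1 (extremePoints_convexHull_subset hv)) hvF
end
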